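/- arXiv:1710.08029 — 3 statements merged into one kernel-verified Lean document; each statement's English description precedes it below -/
import Mathlib

section
/- Let P = (P_0, ..., P_n) ∈ GL_n(F_2)^{n+1} with spreading matrix X. The following are equivalent: (1) the first row and first column of W(P) consist entirely of +1 entries; (2) X is invertible and X^{-1} equals the matrix whose rows are (P_{0:n-1}^{-T} 1_b)^T, (P_{0:n-2}^{-T} 1_b)^T, ..., (P_0^{-T} 1_b)^T; (3) X is invertible and 1_b^T P_{k:ℓ} 1_b = 0 and 1_b^T P_{k:ℓ}^{-1} 1_b = 0 for all 0 < k ≤ ℓ < n. -/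
open Matrix

/-- Binary representation of `i` as a vector in `F_2^n`, most significant bit first. -/
def bits (n : ℕ) (i : Fin (2 ^ n)) : Fin n → ZMod 2 :=
  fun k => if Nat.testBit i.val (n - 1 - k.val) then 1 else 0

/-- The vector `1_b = (0,...,0,1)ᵀ`. -/
def oneb (n : ℕ) : Fin n → ZMod 2 := fun k => if k.val = n - 1 then 1 else 0

/-- Permutation matrix `P(Q)` of the linear permutation `π(Q)`:
entry `(j, i)` is `1` iff `j_b = Q i_b`. -/
def permMat (n : ℕ) (Q : Matrix (Fin n) (Fin n) (ZMod 2)) :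
    Matrix (Fin (2 ^ n)) (Fin (2 ^ n)) ℤ :=
  Matrix.of fun j i => if bits n j = Q.mulVec (bits n i) then 1 else 0

/-- The array of butterflies `I_{2^{n-1}} ⊗ DFT_2`. -/
def butterflies (n : ℕ) : Matrix (Fin (2 ^ n)) (Fin (2 ^ n)) ℤ :=
  Matrix.of fun j i =>
    if j.val / 2 = i.val / 2 then (if j.val % 2 = 1 ∧ i.val % 2 = 1 then -1 else 1) else 0

/-- `W(P) = P(P₀)·(I ⊗ DFT₂)·P(P₁) ⋯ (I ⊗ DFT₂)·P(Pₙ)`. -/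
def W (n : ℕ) (P : ℕ → Matrix (Fin n) (Fin n) (ZMod 2)) :
    Matrix (Fin (2 ^ n)) (Fin (2 ^ n)) ℤ :=
  permMat n (P 0) * (List.ofFn fun k : Fin n => butterflies n * permMat n (P (k.val + 1))).prod

/-- `P_{i:j} = P_i P_{i+1} ⋯ P_j` (identity if `j < i`). -/
def Pseg {n : ℕ} (P : ℕ → Matrix (Fin n) (Fin n) (ZMod 2)) (i j : ℕ) :
    Matrix (Fin n) (Fin n) (ZMod 2) :=
  ((List.range (j + 1 - i)).map fun k => P (i + k)).prod

/-- The spreading matrix `X = (P_{0:n-1}1_b | P_{0:n-2}1_b | ⋯ | P_0 1_b)`. -/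
def spread (n : ℕ) (P : ℕ → Matrix (Fin n) (Fin n) (ZMod 2)) :
    Matrix (Fin n) (Fin n) (ZMod 2) :=
  Matrix.of fun r c => (Pseg P 0 (n - 1 - c.val)).mulVec (oneb n) r

/-- The matrix whose rows are `(P_{0:n-1}^{-T}1_b)ᵀ, ..., (P_0^{-T}1_b)ᵀ`. -/
noncomputable def spreadInvRows (n : ℕ) (P : ℕ → Matrix (Fin n) (Fin n) (ZMod 2)) :
    Matrix (Fin n) (Fin n) (ZMod 2) :=
  Matrix.of fun r c => (Pseg P 0 (n - 1 - r.val))⁻¹.transpose.mulVec (oneb n) c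

/-- The Hadamard matrix `H_n` with entries `(-1)^{⟨i_b, j_b⟩}`. -/
def hadamard (n : ℕ) : Matrix (Fin (2 ^ n)) (Fin (2 ^ n)) ℤ :=
  Matrix.of fun i j => (-1) ^ (∑ k, bits n i k * bits n j k).val

/-- The cyclic bit-rotation matrix `C_n`: ones on the superdiagonal and in the
bottom-left corner. -/
def Cmat (n : ℕ) : Matrix (Fin n) (Fin n) (ZMod 2) :=
  Matrix.of fun k l => if l.val = k.val + 1 ∨ (k.val = n - 1 ∧ l.val = 0) then 1 else 0

section Butterfly
variable {V : Type*} [AddCommGroup V] [Module (ZMod 2) V]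

theorem add_add_cancel_two (x v : V) : x + v + v = x := by
  rw [add_assoc, ZModModule.add_self, add_zero]

/-- The butterfly matrix along the vector `p.1`, with signs given by the functional `p.2`. -/
def butterfly [DecidableEq V] (p : V × Module.Dual (ZMod 2) V) : Matrix V V ℤ :=
  Matrix.of fun y x =>
    (if x = y then (if p.2 y = 0 then 1 else -1) else 0) + if x = y + p.1 then 1 else 0

theorem butterfly_transpose [DecidableEq V] (p : V × Module.Dual (ZMod 2) V) :
    (butterfly p)ᵀ = butterfly p := by
  ext y x
  have h : y = x + p.1 ↔ x = y + p.1 := by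
    constructor <;> (rintro rfl; rw [add_add_cancel_two])
  by_cases hxy : x = y
  · subst hxy; rfl
  · simp [butterfly, hxy, Ne.symm hxy, h]

theorem butterfly_mulVec [DecidableEq V] [Fintype V] (p : V × Module.Dual (ZMod 2) V)
    (f : V → ℤ) (y : V) :
    (butterfly p *ᵥ f) y = (if p.2 y = 0 then 1 else -1) * f y + f (y + p.1) := by
  simp [butterfly, mulVec, dotProduct, add_mul, Finset.sum_add_distrib]

/-- The span of the directions of a list of butterflies. -/
def directionSpan : List (V × Module.Dual (ZMod 2) V) → Submodule (ZMod 2) V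
  | [] => ⊥
  | p :: L => Submodule.span (ZMod 2) {p.1} ⊔ directionSpan L

theorem mem_directionSpan {L : List (V × Module.Dual (ZMod 2) V)}
    {p : V × Module.Dual (ZMod 2) V} (hp : p ∈ L) : p.1 ∈ directionSpan L := by
  induction L with
  | nil => simp at hp
  | cons q L ih =>
    rcases List.mem_cons.1 hp with rfl | h
    · exact Submodule.mem_sup_left (Submodule.mem_span_singleton_self _)
    · exact Submodule.mem_sup_right (ih h)

theorem directionSpan_le {L : List (V × Module.Dual (ZMod 2) V)} {S : Submodule (ZMod 2) V}
    (h : ∀ p ∈ L, p.1 ∈ S) : directionSpan L ≤ S := by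
  induction L with
  | nil => exact bot_le
  | cons q L ih =>
    refine sup_le ?_ (ih fun p hp => h p (List.mem_cons_of_mem _ hp))
    rw [Submodule.span_singleton_le_iff_mem]
    exact h q List.mem_cons_self

theorem mem_span_singleton_sup {v x : V} {S : Submodule (ZMod 2) V} :
    x ∈ Submodule.span (ZMod 2) {v} ⊔ S ↔ x ∈ S ∨ x + v ∈ S := by
  constructor
  · intro h
    obtain ⟨y, hy, z, hz, rfl⟩ := Submodule.mem_sup.1 h
    obtain ⟨a, rfl⟩ := Submodule.mem_span_singleton.1 hy
    have h01 : ∀ a : ZMod 2, a = 0 ∨ a = 1 := by decide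
    obtain rfl | rfl := h01 a
    · left; simpa using hz
    · right
      rwa [one_smul, add_comm v z, add_add_cancel_two]
  · rintro (h | h)
    · exact Submodule.mem_sup_right h
    · rw [← add_add_cancel_two x v]
      exact Submodule.add_mem _ (Submodule.mem_sup_right h)
        (Submodule.mem_sup_left (Submodule.mem_span_singleton_self _))

theorem finrank_span_singleton_le_one (v : V) :
    Module.finrank (ZMod 2) (Submodule.span (ZMod 2) {v}) ≤ 1 := by
  simpa using finrank_span_le_card (R := ZMod 2) ({v} : Set V)

theorem finrank_directionSpan_le [Finite V] (L : List (V × Module.Dual (ZMod 2) V)) :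
    Module.finrank (ZMod 2) (directionSpan L) ≤ L.length := by
  induction L with
  | nil => exact (finrank_bot (ZMod 2) V).le
  | cons q L ih =>
    have h1 := Submodule.finrank_add_le_finrank_add_finrank
      (Submodule.span (ZMod 2) {q.1}) (directionSpan L)
    have h2 := finrank_span_singleton_le_one q.1
    exact h1.trans (by rw [List.length_cons]; omega)

section ListProd
variable [DecidableEq V] [Fintype V]

theorem butterfly_prod_cons (p : V × Module.Dual (ZMod 2) V)
    (L : List (V × Module.Dual (ZMod 2) V)) (y : V) :
    (((p :: L).map butterfly).prod) y 0 =
      (if p.2 y = 0 then 1 else -1) * (L.map butterfly).prod y 0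
        + (L.map butterfly).prod (y + p.1) 0 := by
  rw [List.map_cons, List.prod_cons]
  exact butterfly_mulVec p (fun x => (L.map butterfly).prod x 0) y

theorem butterfly_prod_eq_zero (L : List (V × Module.Dual (ZMod 2) V)) (y : V)
    (hy : y ∉ directionSpan L) : (L.map butterfly).prod y 0 = 0 := by
  induction L generalizing y with
  | nil =>
    have : y ≠ 0 := by simpa [directionSpan] using hy
    simp [this]
  | cons p L ih =>
    rw [directionSpan, mem_span_singleton_sup, not_or] at hy
    rw [butterfly_prod_cons, ih _ hy.1, ih _ hy.2]
    simp

open Classical in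
theorem butterfly_prod_of_pairwise (L : List (V × Module.Dual (ZMod 2) V))
    (h1 : ∀ p ∈ L, p.2 p.1 = 1) (h : L.Pairwise fun p q => p.2 q.1 = 0) (y : V) :
    (L.map butterfly).prod y 0 = if y ∈ directionSpan L then 1 else 0 := by
  induction L generalizing y with
  | nil => simp [directionSpan, Matrix.one_apply]
  | cons p L ih =>
    rw [List.pairwise_cons] at h
    have ih := ih (fun q hq => h1 q (List.mem_cons_of_mem _ hq)) h.2
    have hp := h1 p List.mem_cons_self
    have hk : ∀ z ∈ directionSpan L, p.2 z = 0 := fun z hz =>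
      LinearMap.mem_ker.1 (directionSpan_le (S := LinearMap.ker p.2) h.1 hz)
    rw [butterfly_prod_cons, ih, ih, directionSpan, mem_span_singleton_sup]
    by_cases h2 : y ∈ directionSpan L
    · have h3 : y + p.1 ∉ directionSpan L := fun h3 => by
        have := hk _ h3
        rw [map_add, hk _ h2, hp] at this
        simp at this
      simp [h2, h3, hk _ h2]
    · simp [h2]

open Classical in
theorem directionSpan_eq_of_butterfly_prod (L : List (V × Module.Dual (ZMod 2) V))
    (U : Submodule (ZMod 2) V) (hU : L.length ≤ Module.finrank (ZMod 2) U)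
    (h : ∀ y, (L.map butterfly).prod y 0 = if y ∈ U then 1 else 0) : directionSpan L = U := by
  have hle : U ≤ directionSpan L := fun y hy => by
    by_contra hn
    have := butterfly_prod_eq_zero L y hn
    rw [h, if_pos hy] at this
    exact one_ne_zero this
  exact (Submodule.eq_of_le_of_finrank_le hle ((finrank_directionSpan_le L).trans hU)).symm

open Classical in
theorem pairwise_of_butterfly_prod (L : List (V × Module.Dual (ZMod 2) V))
    (h1 : ∀ p ∈ L, p.2 p.1 = 1) (U : Submodule (ZMod 2) V)
    (hU : L.length ≤ Module.finrank (ZMod 2) U)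
    (h : ∀ y, (L.map butterfly).prod y 0 = if y ∈ U then 1 else 0) :
    L.Pairwise fun p q => p.2 q.1 = 0 := by
  induction L generalizing U with
  | nil => exact List.Pairwise.nil
  | cons p L ih =>
    have hp := h1 p List.mem_cons_self
    have hpU : p.1 ∈ U :=
      directionSpan_eq_of_butterfly_prod _ U hU h ▸ mem_directionSpan List.mem_cons_self
    have hsup : U ≤ Submodule.span (ZMod 2) {p.1} ⊔ (U ⊓ LinearMap.ker p.2) := fun y hy => by
      rw [mem_span_singleton_sup]
      have : ∀ a : ZMod 2, a = 0 ∨ a + 1 = 0 := by decide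
      refine (this (p.2 y)).imp (fun h0 => ⟨hy, h0⟩) fun h0 => ⟨U.add_mem hy hpU, ?_⟩
      simpa [hp] using h0
    have hlen : L.length ≤ Module.finrank (ZMod 2) (U ⊓ LinearMap.ker p.2 : Submodule _ V) := by
      have e1 := Submodule.finrank_mono hsup
      have e2 := Submodule.finrank_add_le_finrank_add_finrank
        (Submodule.span (ZMod 2) {p.1}) (U ⊓ LinearMap.ker p.2)
      have e3 := finrank_span_singleton_le_one p.1
      rw [List.length_cons] at hU
      omega
    have hL : ∀ y, (L.map butterfly).prod y 0 =
        if y ∈ U ⊓ LinearMap.ker p.2 then 1 else 0 := fun y => by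
      have a1 := h y
      have a2 := h (y + p.1)
      rw [butterfly_prod_cons] at a1 a2
      rw [add_add_cancel_two, map_add, hp] at a2
      have hm : y + p.1 ∈ U ↔ y ∈ U := U.add_mem_iff_left hpU
      rw [hm] at a2
      rw [Submodule.mem_inf, LinearMap.mem_ker]
      obtain h0 | h0 : p.2 y = 0 ∨ p.2 y = 1 := by
        generalize p.2 y = a
        revert a; decide
      all_goals
        by_cases hy : y ∈ U <;> simp [h0, hy, CharTwo.add_self_eq_zero] at a1 a2 ⊢ <;> omega
    have h1' : ∀ q ∈ L, q.2 q.1 = 1 := fun q hq => h1 q (List.mem_cons_of_mem _ hq)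
    refine List.pairwise_cons.2 ⟨fun q hq => ?_, ih h1' _ hlen hL⟩
    have : q.1 ∈ U ⊓ LinearMap.ker p.2 :=
      directionSpan_eq_of_butterfly_prod L _ hlen hL ▸ mem_directionSpan hq
    exact this.2

theorem butterfly_prod_col_iff (L : List (V × Module.Dual (ZMod 2) V))
    (h1 : ∀ p ∈ L, p.2 p.1 = 1) (hL : L.length = Module.finrank (ZMod 2) V) :
    (∀ y, (L.map butterfly).prod y 0 = 1) ↔
      L.Pairwise (fun p q => p.2 q.1 = 0) ∧ directionSpan L = ⊤ := by
  classical
  constructor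
  · intro h
    have hU : L.length ≤ Module.finrank (ZMod 2) (⊤ : Submodule (ZMod 2) V) := by
      rw [finrank_top, hL]
    exact ⟨pairwise_of_butterfly_prod L h1 ⊤ hU (by simpa using h),
      directionSpan_eq_of_butterfly_prod L ⊤ hU (by simpa using h)⟩
  · rintro ⟨h, hs⟩ y
    rw [butterfly_prod_of_pairwise L h1 h, hs, if_pos Submodule.mem_top]

theorem butterfly_prod_row_iff (L : List (V × Module.Dual (ZMod 2) V))
    (h1 : ∀ p ∈ L, p.2 p.1 = 1) (hL : L.length = Module.finrank (ZMod 2) V) :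
    (∀ x, (L.map butterfly).prod 0 x = 1) ↔
      L.Pairwise (fun p q => q.2 p.1 = 0) ∧ directionSpan L = ⊤ := by
  have hT : ((L.map butterfly).prod)ᵀ = (L.reverse.map butterfly).prod := by
    rw [transpose_list_prod, List.map_map, List.map_reverse]
    simp [Function.comp_def, butterfly_transpose]
  have hs : directionSpan L.reverse = directionSpan L :=
    le_antisymm (directionSpan_le fun p hp => mem_directionSpan (List.mem_reverse.1 hp))
      (directionSpan_le fun p hp => mem_directionSpan (List.mem_reverse.2 hp))
  rw [← hs, ← List.pairwise_reverse (l := L),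
    ← butterfly_prod_col_iff L.reverse (fun p hp => h1 p (List.mem_reverse.1 hp)) (by simpa), ← hT]
  rfl

end ListProd

end Butterfly

/-- The bits of an index determine it, and every bit vector occurs. -/
theorem bits_bijective (n : ℕ) : Function.Bijective (bits n) := by
  rw [Fintype.bijective_iff_injective_and_card]
  refine ⟨fun i j h => Fin.ext (Nat.eq_of_testBit_eq fun m => ?_), by simp [ZMod.card]⟩
  by_cases hm : m < n
  · have := congrFun h ⟨n - 1 - m, by omega⟩
    simp only [bits, show n - 1 - (n - 1 - m) = m by omega] at this
    cases h1 : i.val.testBit m <;> cases h2 : j.val.testBit m <;> simp_all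
  · have hp : 2 ^ n ≤ 2 ^ m := Nat.pow_le_pow_right (by norm_num) (by omega)
    rw [Nat.testBit_lt_two_pow (i.2.trans_le hp), Nat.testBit_lt_two_pow (j.2.trans_le hp)]

/-- The bijection between indices and bit vectors. -/
noncomputable def bitsEquiv (n : ℕ) : Fin (2 ^ n) ≃ (Fin n → ZMod 2) :=
  Equiv.ofBijective (bits n) (bits_bijective n)

theorem bitsEquiv_apply (n : ℕ) (i : Fin (2 ^ n)) : bitsEquiv n i = bits n i := rfl

theorem bitsEquiv_zero (n : ℕ) (h : 0 < 2 ^ n) : bitsEquiv n ⟨0, h⟩ = 0 := by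
  ext k
  simp [bitsEquiv_apply, bits]

theorem oneb_dotProduct_bits {n : ℕ} (hn : 0 < n) (i : Fin (2 ^ n)) :
    oneb n ⬝ᵥ bits n i = if i.val % 2 = 1 then 1 else 0 := by
  rw [dotProduct, Finset.sum_eq_single ⟨n - 1, by omega⟩]
  · simp [oneb, bits]
  · intro k _ hk
    have : k.val ≠ n - 1 := fun h => hk (Fin.ext h)
    simp [oneb, this]
  · simp

theorem oneb_dotProduct_self {n : ℕ} (hn : 0 < n) : oneb n ⬝ᵥ oneb n = 1 := by
  rw [dotProduct, Finset.sum_eq_single ⟨n - 1, by omega⟩]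
  · simp [oneb]
  · intro k _ hk
    have : k.val ≠ n - 1 := fun h => hk (Fin.ext h)
    simp [oneb, this]
  · simp

theorem bits_eq_add_oneb_iff {n : ℕ} (hn : 0 < n) (i j : Fin (2 ^ n)) :
    bits n i = bits n j + oneb n ↔ i.val / 2 = j.val / 2 ∧ i.val % 2 ≠ j.val % 2 := by
  have hb : ∀ (i : Fin (2 ^ n)) (k : Fin n), bits n i k =
      if k.val = n - 1 then (if i.val % 2 = 1 then 1 else 0)
      else if (i.val / 2).testBit (n - 1 - k.val - 1) then 1 else 0 := by
    intro i k
    by_cases hk : k.val = n - 1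
    · simp [bits, hk]
    · obtain ⟨m, hm⟩ : ∃ m, n - 1 - k.val = m + 1 := ⟨n - 1 - k.val - 1, by omega⟩
      simp [bits, hk, hm, Nat.testBit_succ]
  constructor
  · intro h
    constructor
    · refine Nat.eq_of_testBit_eq fun m => ?_
      by_cases hm : m + 1 < n
      · have := congrFun h ⟨n - 1 - (m + 1), by omega⟩
        have h1 : n - 1 - (m + 1) ≠ n - 1 := by omega
        rw [Pi.add_apply, hb, hb] at this
        simp only [h1, if_false, oneb, add_zero,
          show n - 1 - (n - 1 - (m + 1)) - 1 = m by omega] at this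
        cases h1 : (i.val / 2).testBit m <;> cases h2 : (j.val / 2).testBit m <;> simp_all
      · have hp : 2 ^ n ≤ 2 ^ (m + 1) := Nat.pow_le_pow_right (by norm_num) (by omega)
        have hi := i.2
        have hj := j.2
        rw [Nat.testBit_lt_two_pow (by omega), Nat.testBit_lt_two_pow (by omega)]
    · have := congrFun h ⟨n - 1, by omega⟩
      rw [Pi.add_apply, hb, hb] at this
      intro he
      simp [oneb, he] at this
  · rintro ⟨h1, h2⟩
    ext1 k
    rw [Pi.add_apply, hb, hb, h1]
    by_cases hk : k.val = n - 1
    · obtain ⟨a, b⟩ | ⟨a, b⟩ :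
          (i.val % 2 = 0 ∧ j.val % 2 = 1) ∨ (i.val % 2 = 1 ∧ j.val % 2 = 0) := by
        omega
      · simp [hk, oneb, a, b, CharTwo.add_self_eq_zero]
      · simp [hk, oneb, a, b]
    · simp [hk, oneb]

/-- The butterfly direction and functional of `I ⊗ DFT₂` after the change of basis `Q`. -/
noncomputable def conjOneb (n : ℕ) (Q : Matrix (Fin n) (Fin n) (ZMod 2)) :
    (Fin n → ZMod 2) × Module.Dual (ZMod 2) (Fin n → ZMod 2) :=
  (Q *ᵥ oneb n, dotProductBilin (ZMod 2) (ZMod 2) (oneb n) ∘ₗ (Q⁻¹).mulVecLin)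

theorem conjOneb_fst (n : ℕ) (Q : Matrix (Fin n) (Fin n) (ZMod 2)) :
    (conjOneb n Q).1 = Q *ᵥ oneb n := rfl

theorem conjOneb_snd_apply (n : ℕ) (Q : Matrix (Fin n) (Fin n) (ZMod 2)) (x : Fin n → ZMod 2) :
    (conjOneb n Q).2 x = oneb n ⬝ᵥ (Q⁻¹ *ᵥ x) := rfl

theorem conjOneb_snd_conjOneb_fst {n : ℕ} (Q R : Matrix (Fin n) (Fin n) (ZMod 2)) :
    (conjOneb n Q).2 (conjOneb n R).1 = oneb n ⬝ᵥ ((Q⁻¹ * R) *ᵥ oneb n) := by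
  rw [conjOneb_snd_apply, ← mulVec_mulVec]; rfl

theorem butterflies_eq {n : ℕ} (hn : 0 < n) :
    butterflies n = (butterfly (conjOneb n 1)).submatrix (bitsEquiv n) (bitsEquiv n) := by
  ext j i
  have h1 : bits n i = bits n j ↔ i = j := (bits_bijective n).1.eq_iff
  simp only [butterflies, butterfly, conjOneb_snd_apply, conjOneb_fst, of_apply, submatrix_apply,
    bitsEquiv_apply, inv_one, one_mulVec, bits_eq_add_oneb_iff hn, oneb_dotProduct_bits hn, h1]
  by_cases hij : i = j
  · subst hij
    by_cases hi : i.val % 2 = 1 <;> simp [hi]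
  · have hv : i.val ≠ j.val := fun h => hij (Fin.ext h)
    by_cases hd : i.val / 2 = j.val / 2
    · have hm : i.val % 2 ≠ j.val % 2 := by omega
      have hm' : ¬ (j.val % 2 = 1 ∧ i.val % 2 = 1) := by omega
      simp [hij, hd, hm, hm']
    · simp [hij, hd, Ne.symm hd]

theorem permMat_mul_butterflies {n : ℕ} (hn : 0 < n) (Q : Matrix (Fin n) (Fin n) (ZMod 2))
    (hQ : IsUnit Q) :
    permMat n Q * butterflies n =
      (butterfly (conjOneb n Q)).submatrix (bitsEquiv n) (bitsEquiv n) * permMat n Q := by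
  have hdet := (isUnit_iff_isUnit_det Q).1 hQ
  have hinv : ∀ x, Q⁻¹ *ᵥ (Q *ᵥ x) = x := fun x => by
    rw [mulVec_mulVec, nonsing_inv_mul _ hdet, one_mulVec]
  have hinv' : ∀ x, Q *ᵥ (Q⁻¹ *ᵥ x) = x := fun x => by
    rw [mulVec_mulVec, mul_nonsing_inv _ hdet, one_mulVec]
  have hp : permMat n Q = (Matrix.of fun y x : Fin n → ZMod 2 =>
      if y = Q *ᵥ x then (1 : ℤ) else 0).submatrix (bitsEquiv n) (bitsEquiv n) := rfl
  rw [hp, butterflies_eq hn, submatrix_mul_equiv, submatrix_mul_equiv]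
  congr 1
  ext y x
  have e1 : ∀ z, y = Q *ᵥ z ↔ z = Q⁻¹ *ᵥ y := fun z => by
    constructor <;> rintro rfl <;> simp [hinv, hinv']
  have e2 : x = Q⁻¹ *ᵥ y ↔ Q *ᵥ x = y := by rw [← e1, eq_comm]
  have e3 : x = Q⁻¹ *ᵥ y + oneb n ↔ Q *ᵥ x = y + Q *ᵥ oneb n := by
    constructor
    · rintro rfl; rw [mulVec_add, hinv']
    · intro h; rw [← hinv x, h, mulVec_add, hinv]
  simp only [mul_apply, of_apply, e1, ite_mul, one_mul, zero_mul, mul_ite, mul_one, mul_zero,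
    Finset.sum_ite_eq', Finset.mem_univ, if_true]
  simp only [butterfly, conjOneb_snd_apply, conjOneb_fst, of_apply, inv_one, one_mulVec, e2, e3]
  congr!

theorem permMat_mul_permMat {n : ℕ} (Q R : Matrix (Fin n) (Fin n) (ZMod 2)) :
    permMat n Q * permMat n R = permMat n (Q * R) := by
  have hp : ∀ Q, permMat n Q = (Matrix.of fun y x : Fin n → ZMod 2 =>
      if y = Q *ᵥ x then (1 : ℤ) else 0).submatrix (bitsEquiv n) (bitsEquiv n) := fun _ => rfl
  rw [hp, hp, hp, submatrix_mul_equiv]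
  congr 1
  ext y x
  simp [mul_apply, ← mulVec_mulVec]

section Pseg
variable {n : ℕ} (P : ℕ → Matrix (Fin n) (Fin n) (ZMod 2))

theorem Pseg_mul_Pseg {i j k : ℕ} (hij : i ≤ j + 1) (hjk : j ≤ k) :
    Pseg P i j * Pseg P (j + 1) k = Pseg P i k := by
  obtain ⟨a, ha⟩ : ∃ a, j + 1 = i + a := ⟨j + 1 - i, by omega⟩
  obtain ⟨b, rfl⟩ : ∃ b, k = j + b := ⟨k - j, by omega⟩
  simp only [Pseg, show j + 1 - i = a by omega, show j + b + 1 - (j + 1) = b by omega,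
    show j + b + 1 - i = a + b by omega]
  rw [List.range_add, List.map_append, List.prod_append, List.map_map, ha]
  simp [Function.comp_def, add_assoc]

theorem Pseg_self (k : ℕ) : Pseg P k k = P k := by simp [Pseg]

variable {P} in
theorem isUnit_Pseg (hP : ∀ k ≤ n, IsUnit (P k)) {i j : ℕ} (hj : j ≤ n) : IsUnit (Pseg P i j) := by
  refine List.prod_induction IsUnit (fun _ _ => IsUnit.mul) isUnit_one fun M hM => ?_
  obtain ⟨k, hk, rfl⟩ := List.mem_map.1 hM
  exact hP _ (by rw [List.mem_range] at hk; omega)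

variable {P} in
theorem permMat_mul_prod (hP : ∀ k ≤ n, IsUnit (P k)) (m : ℕ) (hm : m ≤ n) :
    permMat n (P 0) * (List.ofFn fun k : Fin m => butterflies n * permMat n (P (k.val + 1))).prod =
      ((List.ofFn fun k : Fin m => conjOneb n (Pseg P 0 k.val)).map butterfly).prod.submatrix
        (bitsEquiv n) (bitsEquiv n) * permMat n (Pseg P 0 m) := by
  induction m with
  | zero => simp [Pseg_self]
  | succ m ih =>
    rw [List.ofFn_succ_last, List.prod_append, ← mul_assoc, List.ofFn_succ_last, List.map_append,
      List.prod_append]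
    simp only [Fin.val_castSucc, Fin.val_last, List.prod_singleton, List.map_singleton]
    rw [ih (by omega), mul_assoc, ← mul_assoc (permMat n _),
      permMat_mul_butterflies (by omega) _ (isUnit_Pseg hP (by omega)), mul_assoc,
      permMat_mul_permMat, ← mul_assoc, submatrix_mul_equiv, ← Pseg_self P (m + 1),
      Pseg_mul_Pseg P (by omega) (by omega)]

variable {P} in
theorem W_eq (hP : ∀ k ≤ n, IsUnit (P k)) (y x : Fin (2 ^ n)) :
    W n P y x = ((List.ofFn fun k : Fin n => conjOneb n (Pseg P 0 k.val)).map butterfly).prod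
      (bits n y) (Pseg P 0 n *ᵥ bits n x) := by
  rw [W, permMat_mul_prod hP n le_rfl]
  have hp : permMat n (Pseg P 0 n) = (Matrix.of fun y x : Fin n → ZMod 2 =>
      if y = Pseg P 0 n *ᵥ x then (1 : ℤ) else 0).submatrix (bitsEquiv n) (bitsEquiv n) := rfl
  rw [hp, submatrix_mul_equiv]
  simp [mul_apply, bitsEquiv_apply]

theorem spreadInvRows_mul_spread (r c : Fin n) :
    (spreadInvRows n P * spread n P) r c =
      (conjOneb n (Pseg P 0 (n - 1 - r.val))).2 (conjOneb n (Pseg P 0 (n - 1 - c.val))).1 := by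
  rw [conjOneb_snd_apply, dotProduct_mulVec, ← mulVec_transpose]
  rfl

variable {P} in
theorem conjOneb_self (hP : ∀ k ≤ n, IsUnit (P k)) {i : ℕ} (hi : i < n) :
    (conjOneb n (Pseg P 0 i)).2 (conjOneb n (Pseg P 0 i)).1 = 1 := by
  rw [conjOneb_snd_conjOneb_fst, nonsing_inv_mul _
    ((isUnit_iff_isUnit_det _).1 (isUnit_Pseg hP hi.le)), one_mulVec,
    oneb_dotProduct_self (by omega)]

variable {P} in
theorem conjOneb_of_lt (hP : ∀ k ≤ n, IsUnit (P k)) {i j : ℕ} (hij : i < j) (hj : j < n) :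
    (conjOneb n (Pseg P 0 i)).2 (conjOneb n (Pseg P 0 j)).1 =
        oneb n ⬝ᵥ (Pseg P (i + 1) j *ᵥ oneb n) ∧
      (conjOneb n (Pseg P 0 j)).2 (conjOneb n (Pseg P 0 i)).1 =
        oneb n ⬝ᵥ ((Pseg P (i + 1) j)⁻¹ *ᵥ oneb n) := by
  have hdet := (isUnit_iff_isUnit_det _).1 (isUnit_Pseg hP (i := 0) (j := i) (by omega))
  rw [conjOneb_snd_conjOneb_fst, conjOneb_snd_conjOneb_fst,
    ← Pseg_mul_Pseg P (i := 0) (by omega) hij.le, Matrix.mul_inv_rev, mul_assoc,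
    nonsing_inv_mul _ hdet, ← mul_assoc, nonsing_inv_mul _ hdet, one_mul, mul_one]
  exact ⟨rfl, rfl⟩

variable {P} in
theorem spreadInvRows_mul_spread_eq_one_iff (hP : ∀ k ≤ n, IsUnit (P k)) :
    spreadInvRows n P * spread n P = 1 ↔ ∀ i j : ℕ, i < j → j < n →
      (conjOneb n (Pseg P 0 i)).2 (conjOneb n (Pseg P 0 j)).1 = 0 ∧
      (conjOneb n (Pseg P 0 j)).2 (conjOneb n (Pseg P 0 i)).1 = 0 := by
  constructor
  · intro h i j hij hj
    have key : ∀ a b : ℕ, a < n → b < n → a ≠ b →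
        (conjOneb n (Pseg P 0 a)).2 (conjOneb n (Pseg P 0 b)).1 = 0 := fun a b ha hb hab => by
      have e := spreadInvRows_mul_spread P ⟨n - 1 - a, by omega⟩ ⟨n - 1 - b, by omega⟩
      rw [h, one_apply_ne (by rw [Ne, Fin.mk.injEq]; omega)] at e
      simp only [show n - 1 - (n - 1 - a) = a by omega, show n - 1 - (n - 1 - b) = b by omega] at e
      exact e.symm
    exact ⟨key i j (by omega) hj hij.ne, key j i hj (by omega) hij.ne'⟩
  · intro h
    ext r c
    rw [spreadInvRows_mul_spread]
    have hr := r.2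
    have hc := c.2
    rcases lt_trichotomy r.val c.val with hrc | hrc | hrc
    · rw [one_apply_ne (Fin.ne_of_lt hrc)]
      exact (h (n - 1 - c.val) (n - 1 - r.val) (by omega) (by omega)).2
    · rw [Fin.ext hrc, one_apply_eq]
      exact conjOneb_self hP (by omega)
    · rw [one_apply_ne (Fin.ne_of_gt hrc)]
      exact (h (n - 1 - r.val) (n - 1 - c.val) (by omega) (by omega)).1

variable {P} in
theorem directionSpan_eq_top (h : spreadInvRows n P * spread n P = 1) :
    directionSpan (List.ofFn fun k : Fin n => conjOneb n (Pseg P 0 k.val)) = ⊤ := by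
  rw [eq_top_iff]
  intro x _
  rw [← one_mulVec x, ← mul_eq_one_comm.1 h, ← mulVec_mulVec, mulVec_eq_sum]
  refine Submodule.sum_mem _ fun c _ => ?_
  have hm : conjOneb n (Pseg P 0 (n - 1 - c.val)) ∈
      List.ofFn fun k : Fin n => conjOneb n (Pseg P 0 k.val) :=
    List.mem_ofFn.2 ⟨⟨n - 1 - c.val, by have := c.2; omega⟩, rfl⟩
  rw [op_smul_eq_smul]
  exact Submodule.smul_mem _ _ (mem_directionSpan hm)

variable {P} in
theorem W_row_col_iff (hP : ∀ k ≤ n, IsUnit (P k)) (h0 : 0 < 2 ^ n) :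
    ((∀ j, W n P j ⟨0, h0⟩ = 1) ∧ ∀ i, W n P ⟨0, h0⟩ i = 1) ↔
      spreadInvRows n P * spread n P = 1 := by
  set L := List.ofFn fun k : Fin n => conjOneb n (Pseg P 0 k.val) with hL
  have h1 : ∀ p ∈ L, p.2 p.1 = 1 := fun p hp => by
    obtain ⟨k, rfl⟩ := List.mem_ofFn.1 hp
    exact conjOneb_self hP k.2
  have hlen : L.length = Module.finrank (ZMod 2) (Fin n → ZMod 2) := by simp [hL]
  have hz : bits n ⟨0, h0⟩ = 0 := bitsEquiv_zero n h0
  have hcol : (∀ j, W n P j ⟨0, h0⟩ = 1) ↔ ∀ y, (L.map butterfly).prod y 0 = 1 := by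
    rw [← (bitsEquiv n).forall_congr_right]
    simp only [W_eq hP, hz, mulVec_zero, bitsEquiv_apply, hL]
  have hrow : (∀ i, W n P ⟨0, h0⟩ i = 1) ↔ ∀ x, (L.map butterfly).prod 0 x = 1 := by
    have hs : Function.Surjective fun i => Pseg P 0 n *ᵥ bits n i :=
      (mulVec_surjective_iff_isUnit.2 (isUnit_Pseg hP le_rfl)).comp (bits_bijective n).2
    rw [hs.forall]
    simp only [W_eq hP, hz, hL]
  rw [hcol, hrow, butterfly_prod_col_iff L h1 hlen, butterfly_prod_row_iff L h1 hlen, hL,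
    List.pairwise_ofFn, List.pairwise_ofFn]
  constructor
  · rintro ⟨⟨ha, -⟩, hb, -⟩
    exact (spreadInvRows_mul_spread_eq_one_iff hP).2 fun i j hij hj =>
      ⟨@ha ⟨i, by omega⟩ ⟨j, hj⟩ hij, @hb ⟨i, by omega⟩ ⟨j, hj⟩ hij⟩
  · intro h
    have hk := (spreadInvRows_mul_spread_eq_one_iff hP).1 h
    exact ⟨⟨fun i j hij => (hk i j hij j.2).1, directionSpan_eq_top h⟩,
      fun i j hij => (hk i j hij j.2).2, directionSpan_eq_top h⟩

end Pseg

/-- Lemma 2: the following are equivalent: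
(1) the first row and first column of `W(P)` consist entirely of `+1` entries;
(2) `X` is invertible with `X⁻¹ = (P_{0:n-1}^{-T}1_b | ⋯ | P_0^{-T}1_b)ᵀ`;
(3) `X` is invertible and `1_bᵀ P_{k:ℓ} 1_b = 0 = 1_bᵀ P_{k:ℓ}⁻¹ 1_b` for all
`0 < k ≤ ℓ < n`. -/
theorem first_row_col_ones_iff (n : ℕ) (P : ℕ → Matrix (Fin n) (Fin n) (ZMod 2))
    (hP : ∀ k ≤ n, IsUnit (P k)) :
    (((∀ j : Fin (2 ^ n), W n P j ⟨0, by positivity⟩ = 1) ∧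
        (∀ i : Fin (2 ^ n), W n P ⟨0, by positivity⟩ i = 1)) ↔
      (IsUnit (spread n P) ∧ (spread n P)⁻¹ = spreadInvRows n P)) ∧
    (((∀ j : Fin (2 ^ n), W n P j ⟨0, by positivity⟩ = 1) ∧
        (∀ i : Fin (2 ^ n), W n P ⟨0, by positivity⟩ i = 1)) ↔
      (IsUnit (spread n P) ∧ ∀ k l : ℕ, 0 < k → k ≤ l → l < n →
        oneb n ⬝ᵥ (Pseg P k l).mulVec (oneb n) = 0 ∧
        oneb n ⬝ᵥ (Pseg P k l)⁻¹.mulVec (oneb n) = 0)) := by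
  rw [W_row_col_iff hP]
  constructor
  · constructor
    · intro h
      exact ⟨IsUnit.of_mul_eq_one_right _ h, inv_eq_left_inv h⟩
    · rintro ⟨hu, h⟩
      rw [← h, nonsing_inv_mul _ ((isUnit_iff_isUnit_det _).1 hu)]
  · constructor
    · intro h
      refine ⟨IsUnit.of_mul_eq_one_right _ h, fun k l hk hkl hl => ?_⟩
      obtain ⟨i, rfl⟩ : ∃ i, k = i + 1 := ⟨k - 1, by omega⟩
      obtain ⟨h1, h2⟩ := conjOneb_of_lt hP (i := i) (j := l) (by omega) hl
      rw [← h1, ← h2]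
      exact (spreadInvRows_mul_spread_eq_one_iff hP).1 h i l (by omega) hl
    · rintro ⟨-, h⟩
      refine (spreadInvRows_mul_spread_eq_one_iff hP).2 fun i j hij hj => ?_
      obtain ⟨h1, h2⟩ := conjOneb_of_lt hP hij hj
      rw [h1, h2]
      exact h (i + 1) j (by omega) (by omega) hj
end

section
/- The map sending (B, Q_1, ..., Q_n) ∈ GL_n(F_2) × GL_{n-1}(F_2)^n to the sequence P given by P_0 = B·diag(Q_1,1), P_i = diag(Q_i^{-1},1)·C_n·diag(Q_{i+1},1) for 0 < i < n, and P_n = diag(Q_n^{-1},1)·C_n·B^T is injective. Consequently, the number of DFT_2-based linear fast WHT algorithms is |P| = ∏_{i=0}^{n-1}(2^n − 2^i) · (∏_{i=0}^{n-2}(2^{n-1} − 2^i))^n. -/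
open Matrix

/-- The Hadamard matrix `H_n` with entries `(-1)^{⟨i_b, j_b⟩}`. -/
def hadamardH (n : ℕ) : Matrix (Fin (2 ^ n)) (Fin (2 ^ n)) ℤ :=
  Matrix.of fun i j => (-1) ^ (∑ k, bits n i k * bits n j k).val

/-- `diag(Q, 1)`: block-diagonal matrix with block `Q` and a `1` in the
bottom-right corner. -/
def diagOne (m : ℕ) (Q : Matrix (Fin m) (Fin m) (ZMod 2)) :
    Matrix (Fin (m + 1)) (Fin (m + 1)) (ZMod 2) :=
  Matrix.reindex finSumFinEquiv finSumFinEquiv (Matrix.fromBlocks Q 0 0 1)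

/-- The sequence `P` produced from `(B, Q_1, ..., Q_n)` by the enumeration corollary
formulas, for `n = m + 1`. -/
noncomputable def mkP (m : ℕ) (B : Matrix (Fin (m + 1)) (Fin (m + 1)) (ZMod 2))
    (Q : ℕ → Matrix (Fin m) (Fin m) (ZMod 2)) :
    ℕ → Matrix (Fin (m + 1)) (Fin (m + 1)) (ZMod 2) := fun i =>
  if i = 0 then B * diagOne m (Q 1)
  else if i < m + 1 then diagOne m (Q i)⁻¹ * Cmat (m + 1) * diagOne m (Q (i + 1))
  else if i = m + 1 then diagOne m (Q (m + 1))⁻¹ * Cmat (m + 1) * Bᵀ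
  else 1

theorem bits_injective (n : ℕ) : Function.Injective (bits n) := by
  intro i j h
  apply Fin.ext
  apply Nat.eq_of_testBit_eq
  intro t
  by_cases ht : t < n
  · have h1 := congrFun h ⟨n - 1 - t, by omega⟩
    have h2 : n - 1 - (n - 1 - t) = t := by omega
    simp only [bits, h2] at h1
    revert h1
    cases i.val.testBit t <;> cases j.val.testBit t <;> simp
  · have h2 : 2 ^ n ≤ 2 ^ t := Nat.pow_le_pow_right (by norm_num) (by omega)
    rw [Nat.testBit_lt_two_pow (i.isLt.trans_le h2), Nat.testBit_lt_two_pow (j.isLt.trans_le h2)]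

theorem zmod_two_eq_zero_or_one (a : ZMod 2) : a = 0 ∨ a = 1 := by
  revert a; decide

/-- The sign character `a ↦ (-1) ^ a` of `F_2`. -/
def sgn (a : ZMod 2) : ℤ := (-1) ^ a.val

theorem sgn_add (a b : ZMod 2) : sgn (a + b) = sgn a * sgn b := by
  revert a b; decide

theorem sgn_injective : Function.Injective sgn := by
  unfold Function.Injective; decide

theorem sgn_ne_zero (a : ZMod 2) : sgn a ≠ 0 := by
  revert a; decide

/-- The matrix of the linear map `Q`, indexed by vectors over `F_2`. -/
def vecPerm {n : ℕ} (Q : Matrix (Fin n) (Fin n) (ZMod 2)) :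
    Matrix (Fin n → ZMod 2) (Fin n → ZMod 2) ℤ :=
  Matrix.of fun u v => if u = Q *ᵥ v then 1 else 0

/-- The butterfly in direction `x` relative to the linear form `y`. -/
def vecButterfly {n : ℕ} (x y : Fin n → ZMod 2) :
    Matrix (Fin n → ZMod 2) (Fin n → ZMod 2) ℤ :=
  Matrix.of fun u v => if v = u ∨ v = u + x then sgn ((y ⬝ᵥ u) * (y ⬝ᵥ v)) else 0

theorem permMat_eq_submatrix (n : ℕ) (Q : Matrix (Fin n) (Fin n) (ZMod 2)) :
    permMat n Q = (vecPerm Q).submatrix (bitsEquiv n) (bitsEquiv n) := rfl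

theorem bits_last (m : ℕ) (i : Fin (2 ^ (m + 1))) :
    bits (m + 1) i (Fin.last m) = if i.val % 2 = 1 then 1 else 0 := by
  simp [bits, Nat.testBit_zero]

theorem bits_eq_or_iff (m : ℕ) (i j : Fin (2 ^ (m + 1))) :
    (bits (m + 1) i = bits (m + 1) j ∨
      bits (m + 1) i = bits (m + 1) j + Pi.single (Fin.last m) 1) ↔ j.val / 2 = i.val / 2 := by
  constructor
  · intro h
    have key : ∀ k, k ≠ Fin.last m → bits (m + 1) i k = bits (m + 1) j k := by
      intro k hk
      rcases h with h | h
      · rw [h]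
      · rw [h]; simp [hk]
    apply Nat.eq_of_testBit_eq
    intro t
    rw [← Nat.testBit_add_one, ← Nat.testBit_add_one]
    by_cases ht : t < m
    · have h1 := key ⟨m - (t + 1), by omega⟩
        (Fin.ne_of_val_ne (by simp only [Fin.val_last]; omega))
      have h2 : m - (m - (t + 1)) = t + 1 := by omega
      simp only [bits, add_tsub_cancel_right, h2] at h1
      revert h1
      cases i.val.testBit (t + 1) <;> cases j.val.testBit (t + 1) <;> simp
    · have h2 : 2 ^ (m + 1) ≤ 2 ^ (t + 1) := Nat.pow_le_pow_right (by norm_num) (by omega)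
      rw [Nat.testBit_lt_two_pow (i.isLt.trans_le h2),
        Nat.testBit_lt_two_pow (j.isLt.trans_le h2)]
  · intro h
    have key : ∀ k, k ≠ Fin.last m → bits (m + 1) i k = bits (m + 1) j k := by
      intro k hk
      have hk' : k.val < m := Fin.val_lt_last hk
      have h2 : m - k.val = (m - k.val - 1) + 1 := by omega
      simp only [bits, add_tsub_cancel_right]
      rw [h2, Nat.testBit_add_one, Nat.testBit_add_one, h]
    by_cases hl : bits (m + 1) i (Fin.last m) = bits (m + 1) j (Fin.last m)
    · left
      funext k
      by_cases hk : k = Fin.last m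
      · rw [hk, hl]
      · exact key k hk
    · right
      funext k
      by_cases hk : k = Fin.last m
      · subst hk
        simp only [Pi.add_apply, Pi.single_eq_same]
        revert hl
        generalize bits (m + 1) i (Fin.last m) = a
        generalize bits (m + 1) j (Fin.last m) = b
        revert a b; decide
      · simp [hk, key k hk]

theorem butterflies_eq_submatrix (m : ℕ) :
    butterflies (m + 1) =
      (vecButterfly (Pi.single (Fin.last m) 1) (Pi.single (Fin.last m) 1)).submatrix
        (bitsEquiv (m + 1)) (bitsEquiv (m + 1)) := by
  ext j i
  have h := bits_eq_or_iff m i j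
  simp only [butterflies, vecButterfly, Matrix.of_apply, Matrix.submatrix_apply, bitsEquiv,
    Equiv.ofBijective_apply, h, single_one_dotProduct, bits_last]
  refine if_congr Iff.rfl ?_ rfl
  by_cases h1 : j.val % 2 = 1 <;> by_cases h2 : i.val % 2 = 1 <;> simp [h1, h2, sgn]
  · rfl

theorem hadamardH_eq_submatrix (n : ℕ) :
    hadamardH n =
      (Matrix.of fun u v : Fin n → ZMod 2 => sgn (u ⬝ᵥ v)).submatrix
        (bitsEquiv n) (bitsEquiv n) := rfl

theorem vecPerm_mul {n : ℕ} (A B : Matrix (Fin n) (Fin n) (ZMod 2)) :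
    vecPerm A * vecPerm B = vecPerm (A * B) := by
  ext u v
  simp [vecPerm, Matrix.mul_apply, Finset.sum_ite_eq', Matrix.mulVec_mulVec]

theorem mul_vecPerm_apply {n : ℕ} (S : Matrix (Fin n → ZMod 2) (Fin n → ZMod 2) ℤ)
    (A : Matrix (Fin n) (Fin n) (ZMod 2)) (u v : Fin n → ZMod 2) :
    (S * vecPerm A) u v = S u (A *ᵥ v) := by
  simp [vecPerm, Matrix.mul_apply]

theorem vecPerm_mul_vecButterfly {n : ℕ} (A : Matrix (Fin n) (Fin n) (ZMod 2)) (hA : IsUnit A)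
    (x y : Fin n → ZMod 2) :
    vecPerm A * vecButterfly x y = vecButterfly (A *ᵥ x) (y ᵥ* A⁻¹) * vecPerm A := by
  have hdet := (Matrix.isUnit_iff_isUnit_det A).1 hA
  ext u v
  obtain ⟨u, rfl⟩ : ∃ u', u = A *ᵥ u' := ⟨A⁻¹ *ᵥ u, by simp [Matrix.mul_nonsing_inv _ hdet]⟩
  have hinj := Matrix.mulVec_injective_of_isUnit hA
  rw [mul_vecPerm_apply]
  simp only [vecPerm, Matrix.mul_apply, Matrix.of_apply, ite_mul, one_mul, zero_mul,
    hinj.eq_iff]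
  simp only [vecButterfly, Matrix.of_apply, Finset.sum_ite_eq, Finset.mem_univ, if_true,
    ← Matrix.mulVec_add, hinj.eq_iff, Matrix.dotProduct_mulVec, Matrix.vecMul_vecMul,
    Matrix.nonsing_inv_mul _ hdet, Matrix.vecMul_one]

/-- Product of the first `r` butterflies in the directions `x k`, relative to the forms `y k`. -/
def butterflyProd {n : ℕ} (x y : ℕ → Fin n → ZMod 2) :
    ℕ → Matrix (Fin n → ZMod 2) (Fin n → ZMod 2) ℤ
  | 0 => 1
  | r + 1 => butterflyProd x y r * vecButterfly (x r) (y r)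

/-- The partial product `P 0 * ⋯ * P k`. -/
def partialProd {n : ℕ} (P : ℕ → Matrix (Fin n) (Fin n) (ZMod 2)) :
    ℕ → Matrix (Fin n) (Fin n) (ZMod 2)
  | 0 => P 0
  | k + 1 => partialProd P k * P (k + 1)

theorem isUnit_partialProd {n : ℕ} {P : ℕ → Matrix (Fin n) (Fin n) (ZMod 2)} {r : ℕ}
    (hP : ∀ k ≤ r, IsUnit (P k)) : IsUnit (partialProd P r) := by
  induction r with
  | zero => exact hP 0 le_rfl
  | succ r ih => exact (ih fun k hk => hP k (by omega)).mul (hP (r + 1) le_rfl)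

theorem permMat_mul_prod_eq (m : ℕ) (P : ℕ → Matrix (Fin (m + 1)) (Fin (m + 1)) (ZMod 2))
    (r : ℕ) (hP : ∀ k < r, IsUnit (P k)) :
    permMat (m + 1) (P 0) *
        (List.ofFn fun k : Fin r => butterflies (m + 1) * permMat (m + 1) (P (k.val + 1))).prod =
      (butterflyProd (fun k => partialProd P k *ᵥ Pi.single (Fin.last m) 1)
        (fun k => Pi.single (Fin.last m) 1 ᵥ* (partialProd P k)⁻¹) r *
          vecPerm (partialProd P r)).submatrix (bitsEquiv (m + 1)) (bitsEquiv (m + 1)) := by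
  induction r with
  | zero => simp [butterflyProd, partialProd, permMat_eq_submatrix]
  | succ r ih =>
    rw [List.ofFn_succ', List.prod_concat, ← mul_assoc]
    simp only [Fin.val_castSucc, Fin.val_last]
    rw [ih fun k hk => hP k (by omega), butterflies_eq_submatrix, permMat_eq_submatrix,
      Matrix.submatrix_mul_equiv, Matrix.submatrix_mul_equiv, mul_assoc, ← mul_assoc (vecPerm _),
      vecPerm_mul_vecButterfly _ (isUnit_partialProd fun k hk => hP k (by omega)), mul_assoc,
      vecPerm_mul, ← mul_assoc]
    rfl

theorem W_eq_hadamardH_iff_forall (m : ℕ)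
    (P : ℕ → Matrix (Fin (m + 1)) (Fin (m + 1)) (ZMod 2)) (hP : ∀ k ≤ m, IsUnit (P k)) :
    W (m + 1) P = hadamardH (m + 1) ↔ ∀ u v,
      butterflyProd (fun k => partialProd P k *ᵥ Pi.single (Fin.last m) 1)
        (fun k => Pi.single (Fin.last m) 1 ᵥ* (partialProd P k)⁻¹) (m + 1) u
          (partialProd P (m + 1) *ᵥ v) = sgn (u ⬝ᵥ v) := by
  rw [W, permMat_mul_prod_eq m P (m + 1) fun k hk => hP k (by omega), hadamardH_eq_submatrix]
  constructor
  · intro h u v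
    have := congrFun (congrFun h ((bitsEquiv (m + 1)).symm u)) ((bitsEquiv (m + 1)).symm v)
    simpa [mul_vecPerm_apply] using this
  · intro h
    ext i j
    rw [Matrix.submatrix_apply, mul_vecPerm_apply, h]
    rfl

theorem exists_sum_of_butterflyProd_ne_zero {n : ℕ} {x y : ℕ → Fin n → ZMod 2} {r : ℕ}
    {u v : Fin n → ZMod 2} (h : butterflyProd x y r u v ≠ 0) :
    ∃ ε : ℕ → ZMod 2, v = u + ∑ k ∈ Finset.range r, ε k • x k := by
  induction r generalizing v with
  | zero =>
    refine ⟨0, ?_⟩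
    by_contra hne
    apply h
    have : u ≠ v := by rintro rfl; simp at hne
    simp [butterflyProd, this]
  | succ r ih =>
    rw [butterflyProd, Matrix.mul_apply] at h
    obtain ⟨w, -, hw⟩ := Finset.exists_ne_zero_of_sum_ne_zero h
    obtain ⟨ε, hε⟩ := ih (left_ne_zero_of_mul hw)
    have h2 := right_ne_zero_of_mul hw
    have h3 : v = w ∨ v = w + x r := by
      by_contra hc
      simp [vecButterfly, hc] at h2
    obtain ⟨c, hc⟩ : ∃ c : ZMod 2, v = w + c • x r := by
      rcases h3 with h3 | h3
      · exact ⟨0, by simp [h3]⟩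
      · exact ⟨1, by simp [h3]⟩
    refine ⟨Function.update ε r c, ?_⟩
    rw [Finset.sum_range_succ, Function.update_self, hc, hε, add_assoc]
    congr 2
    refine Finset.sum_congr rfl fun k hk => ?_
    rw [Function.update_of_ne (Finset.mem_range.1 hk).ne]

theorem butterflyProd_apply {n : ℕ} {x y : ℕ → Fin n → ZMod 2} {N : ℕ}
    (hx : ∀ ε : ℕ → ZMod 2, ∑ k ∈ Finset.range N, ε k • x k = 0 → ∀ k < N, ε k = 0)
    (hxy : ∀ k < N, y k ⬝ᵥ x k = 1) {r : ℕ} (hr : r ≤ N)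
    (u : Fin n → ZMod 2) (ε : ℕ → ZMod 2) :
    butterflyProd x y r u (u + ∑ k ∈ Finset.range r, ε k • x k) =
      sgn (∑ k ∈ Finset.range r,
        (1 + ε k) * (y k ⬝ᵥ (u + ∑ l ∈ Finset.range k, ε l • x l))) := by
  induction r with
  | zero => rw [Finset.sum_range_zero, add_zero, butterflyProd, Matrix.one_apply_eq]; rfl
  | succ r ih =>
    set w := u + ∑ k ∈ Finset.range r, ε k • x k with hw
    have hv : u + ∑ k ∈ Finset.range (r + 1), ε k • x k = w + ε r • x r := by
      rw [Finset.sum_range_succ, hw, add_assoc]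
    rw [hv, butterflyProd, Matrix.mul_apply, Finset.sum_range_succ, sgn_add, ← hw,
      ← ih (by omega)]
    have htwo : ∀ a : Fin n → ZMod 2, a + a = 0 := fun a =>
      funext fun i => CharTwo.add_self_eq_zero (a i)
    rw [Finset.sum_eq_single w]
    · congr 1
      have h1 : w + ε r • x r = w ∨ w + ε r • x r = w + x r := by
        rcases zmod_two_eq_zero_or_one (ε r) with h | h <;> simp [h]
      simp only [vecButterfly, Matrix.of_apply, if_pos h1]
      congr 1
      rw [dotProduct_add (y r) w, dotProduct_smul, hxy r (by omega)]
      generalize y r ⬝ᵥ w = a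
      generalize ε r = b
      revert a b; decide
    · intro w' _ hne
      by_contra h0
      obtain ⟨δ, hδ⟩ := exists_sum_of_butterflyProd_ne_zero (left_ne_zero_of_mul h0)
      have h2 := right_ne_zero_of_mul h0
      have h3 : w + ε r • x r = w' ∨ w + ε r • x r = w' + x r := by
        by_contra hc
        simp [vecButterfly, hc] at h2
      have h4 : w' = w + x r := by
        rcases zmod_two_eq_zero_or_one (ε r) with h | h <;> rw [h] at h3 <;>
          simp only [zero_smul, add_zero, one_smul, add_left_inj] at h3
        · rcases h3 with h3 | h3
          · exact absurd h3.symm hne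
          · rw [h3, add_assoc, htwo, add_zero]
        · rcases h3 with h3 | h3
          · exact h3.symm
          · exact absurd h3.symm hne
      have h5 := hx (fun k => if k < r then ε k + δ k else if k = r then 1 else 0) ?_ r (by omega)
      · simp at h5
      · rw [← Finset.sum_subset (Finset.range_subset_range.2 hr), Finset.sum_range_succ]
        · have h6 : ∑ k ∈ Finset.range r,
              (if k < r then ε k + δ k else if k = r then 1 else 0) • x k =
              ∑ k ∈ Finset.range r, ε k • x k + ∑ k ∈ Finset.range r, δ k • x k := by
            rw [← Finset.sum_add_distrib]
            refine Finset.sum_congr rfl fun k hk => ?_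
            rw [if_pos (Finset.mem_range.1 hk), add_smul]
          rw [h6]
          simp only [lt_irrefl, if_false, if_true, one_smul]
          rw [hδ, hw, add_assoc, add_right_inj] at h4
          rw [h4, ← add_assoc, htwo, zero_add, htwo]
        · intro k _ hk
          have hk' : ¬ k < r + 1 := by simpa using hk
          rw [if_neg (by omega), if_neg (by omega), zero_smul]
    · simp

/-- The square matrix with columns `x (n - 1), …, x 0`. -/
def revCols {n : ℕ} (x : ℕ → Fin n → ZMod 2) : Matrix (Fin n) (Fin n) (ZMod 2) :=
  Matrix.of fun r c => x (Fin.rev c) r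

theorem revCols_mulVec {n : ℕ} (x : ℕ → Fin n → ZMod 2) (ε : ℕ → ZMod 2) :
    revCols x *ᵥ (fun c => ε (Fin.rev c)) = ∑ k ∈ Finset.range n, ε k • x k := by
  rw [Finset.sum_range, ← Equiv.sum_comp Fin.revPerm]
  ext r
  simp [revCols, Matrix.mulVec, dotProduct, mul_comm]

theorem transpose_revCols_mul_apply {n : ℕ} (x y : ℕ → Fin n → ZMod 2) (i j : Fin n) :
    ((revCols y)ᵀ * revCols x) i j = y (Fin.rev i) ⬝ᵥ x (Fin.rev j) := by
  simp [revCols, Matrix.mul_apply, dotProduct]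

theorem transpose_revCols_mul_eq_one_iff {n : ℕ} {x y : ℕ → Fin n → ZMod 2} :
    (revCols y)ᵀ * revCols x = 1 ↔
      ∀ k < n, ∀ l < n, y k ⬝ᵥ x l = if k = l then 1 else 0 := by
  constructor
  · intro h k hk l hl
    have := transpose_revCols_mul_apply x y (Fin.rev ⟨k, hk⟩) (Fin.rev ⟨l, hl⟩)
    rw [h] at this
    simpa [Matrix.one_apply] using this.symm
  · intro h
    ext i j
    rw [transpose_revCols_mul_apply, h _ (Fin.is_lt _) _ (Fin.is_lt _), Matrix.one_apply]
    have : (Fin.rev i).val = (Fin.rev j).val ↔ i = j := by rw [← Fin.ext_iff, Fin.rev_inj]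
    simp only [this]

theorem eq_zero_of_sum_smul_eq_zero {n : ℕ} {x : ℕ → Fin n → ZMod 2} (hx : IsUnit (revCols x))
    (ε : ℕ → ZMod 2) (h : ∑ k ∈ Finset.range n, ε k • x k = 0) (k : ℕ) (hk : k < n) :
    ε k = 0 := by
  rw [← revCols_mulVec] at h
  have h2 := Matrix.mulVec_injective_of_isUnit hx (h.trans (Matrix.mulVec_zero _).symm)
  simpa using congrFun h2 (Fin.rev ⟨k, hk⟩)

theorem isUnit_revCols_of_butterflyProd_ne_zero {n : ℕ} {x y : ℕ → Fin n → ZMod 2}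
    (h : ∀ v, butterflyProd x y n 0 v ≠ 0) : IsUnit (revCols x) := by
  rw [← Matrix.mulVec_surjective_iff_isUnit]
  intro v
  obtain ⟨ε, hε⟩ := exists_sum_of_butterflyProd_ne_zero (h v)
  exact ⟨_, by rw [revCols_mulVec, hε, zero_add]⟩

theorem butterflyProd_eq_hadamard_iff {n : ℕ} {x y : ℕ → Fin n → ZMod 2}
    {A : Matrix (Fin n) (Fin n) (ZMod 2)} (hA : IsUnit A) (hxy : ∀ k < n, y k ⬝ᵥ x k = 1) :
    (∀ u v, butterflyProd x y n u (A *ᵥ v) = sgn (u ⬝ᵥ v)) ↔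
      (revCols y)ᵀ * revCols x = 1 ∧ A = revCols x * (revCols x)ᵀ := by
  have hdet := (Matrix.isUnit_iff_isUnit_det A).1 hA
  constructor
  · intro h
    have hB : IsUnit (revCols x) := by
      refine isUnit_revCols_of_butterflyProd_ne_zero (y := y) fun v => ?_
      have := h 0 (A⁻¹ *ᵥ v)
      rw [Matrix.mulVec_mulVec, Matrix.mul_nonsing_inv _ hdet, Matrix.one_mulVec] at this
      rw [this]
      exact sgn_ne_zero _
    have hE : ∀ (u : Fin n → ZMod 2) (ε : ℕ → ZMod 2),
        ∑ k ∈ Finset.range n, (1 + ε k) * (y k ⬝ᵥ (u + ∑ l ∈ Finset.range k, ε l • x l)) =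
          u ⬝ᵥ A⁻¹ *ᵥ (u + ∑ k ∈ Finset.range n, ε k • x k) := by
      intro u ε
      apply sgn_injective
      rw [← butterflyProd_apply (eq_zero_of_sum_smul_eq_zero hB) hxy le_rfl, ← h,
        Matrix.mulVec_mulVec, Matrix.mul_nonsing_inv _ hdet, Matrix.one_mulVec]
    have hG : ∀ ε : ℕ → ZMod 2, ∑ k ∈ Finset.range n,
        (1 + ε k) * (y k ⬝ᵥ ∑ l ∈ Finset.range k, ε l • x l) = 0 := by
      intro ε
      simpa using hE 0 ε
    have hL : ∀ (u : Fin n → ZMod 2) (ε : ℕ → ZMod 2),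
        ∑ k ∈ Finset.range n, (1 + ε k) * (y k ⬝ᵥ u) =
          u ⬝ᵥ A⁻¹ *ᵥ (u + ∑ k ∈ Finset.range n, ε k • x k) := by
      intro u ε
      rw [← hE u ε, ← sub_eq_zero, ← Finset.sum_sub_distrib, ← neg_eq_zero,
        ← Finset.sum_neg_distrib, ← hG ε]
      refine Finset.sum_congr rfl fun k _ => ?_
      rw [dotProduct_add (y k) u]
      ring
    have hQ : ∀ u : Fin n → ZMod 2, ∑ k ∈ Finset.range n, y k ⬝ᵥ u = u ⬝ᵥ A⁻¹ *ᵥ u := by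
      intro u
      simpa using hL u 0
    have hyx : ∀ k < n, ∀ u, y k ⬝ᵥ u = u ⬝ᵥ A⁻¹ *ᵥ x k := by
      intro k hk u
      have h1 := hL u (fun j => if j = k then 1 else 0)
      simp only [add_mul, one_mul, ite_mul, zero_mul, Finset.sum_add_distrib,
        Finset.sum_ite_eq', Finset.mem_range, hk, if_true, hQ, ite_smul, one_smul, zero_smul,
        Matrix.mulVec_add, dotProduct_add, add_right_inj] at h1
      exact h1
    have hsymm : ∀ u v : Fin n → ZMod 2, u ⬝ᵥ A⁻¹ *ᵥ v = v ⬝ᵥ A⁻¹ *ᵥ u := by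
      intro u v
      have h1 := hQ (u + v)
      simp only [dotProduct_add, Finset.sum_add_distrib, hQ, Matrix.mulVec_add,
        add_dotProduct] at h1
      rw [← sub_eq_zero, CharTwo.sub_eq_add]
      linear_combination -h1
    have hlow : ∀ l < n, ∀ k < n, l < k → y k ⬝ᵥ x l = 0 := by
      intro l hl k
      induction k using Nat.strong_induction_on with
      | _ k ih =>
      intro hk hlk
      have h1 := hG (fun j => if j = l ∨ k < j then 1 else 0)
      have hin : ∀ j ≤ k, ∑ i ∈ Finset.range j,
          (if i = l ∨ k < i then (1 : ZMod 2) else 0) • x i = if l < j then x l else 0 := by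
        intro j hj
        rw [Finset.sum_congr rfl (g := fun i => if i = l then x i else 0)]
        · simp
        · intro i hi
          have : ¬ k < i := by have := Finset.mem_range.1 hi; omega
          simp [this]
      rw [Finset.sum_eq_single k] at h1
      · rw [hin k le_rfl, if_pos hlk, if_neg (by omega)] at h1
        simpa using h1
      · intro j hj hjk
        by_cases hj2 : j = l ∨ k < j
        · rw [if_pos hj2, CharTwo.add_self_eq_zero, zero_mul]
        · rw [hin j (by omega)]
          by_cases hlj : l < j
          · rw [if_pos hlj, ih j (by omega) (Finset.mem_range.1 hj) hlj, mul_zero]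
          · rw [if_neg hlj, dotProduct_zero, mul_zero]
      · intro hc
        exact absurd (Finset.mem_range.2 hk) hc
    have hdual : (revCols y)ᵀ * revCols x = 1 := by
      rw [transpose_revCols_mul_eq_one_iff]
      intro k hk l hl
      rcases lt_trichotomy k l with hkl | rfl | hkl
      · rw [if_neg hkl.ne, hyx k hk, hsymm, ← hyx l hl, hlow k hk l hl hkl]
      · rw [if_pos rfl, hxy k hk]
      · rw [if_neg hkl.ne', hlow l hl k hk hkl]
    refine ⟨hdual, ?_⟩
    have hAY : A * revCols y = revCols x := by
      have hY : revCols y = A⁻¹ * revCols x := by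
        ext r c
        have h1 := hyx (Fin.rev c) (Fin.is_lt _) (Pi.single r 1)
        rw [dotProduct_single_one, single_one_dotProduct] at h1
        exact h1
      rw [hY, Matrix.mul_nonsing_inv_cancel_left _ _ hdet]
    have hYB : revCols y * (revCols x)ᵀ = 1 := by
      have := congrArg Matrix.transpose (mul_eq_one_comm.1 hdual)
      simpa using this
    rw [← mul_one A, ← hYB, ← mul_assoc, hAY]
  · rintro ⟨hdual, hAB⟩ u v
    have hB : IsUnit (revCols x) := .of_mul_eq_one_right _ hdual
    set ε : ℕ → ZMod 2 := fun k => y k ⬝ᵥ (A *ᵥ v - u) with hε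
    have hsum : A *ᵥ v = u + ∑ k ∈ Finset.range n, ε k • x k := by
      rw [← revCols_mulVec]
      have : (fun c : Fin n => ε (Fin.rev c)) = (revCols y)ᵀ *ᵥ (A *ᵥ v - u) := rfl
      rw [this, Matrix.mulVec_mulVec, mul_eq_one_comm.1 hdual, Matrix.one_mulVec,
        add_sub_cancel]
    conv_lhs => rw [hsum]
    rw [butterflyProd_apply (eq_zero_of_sum_smul_eq_zero hB) hxy le_rfl]
    congr 1
    have hterm : ∀ k ∈ Finset.range n,
        (1 + ε k) * (y k ⬝ᵥ (u + ∑ l ∈ Finset.range k, ε l • x l)) =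
          (y k ⬝ᵥ u) * (y k ⬝ᵥ A *ᵥ v) := by
      intro k hk
      have hz : y k ⬝ᵥ ∑ l ∈ Finset.range k, ε l • x l = 0 := by
        rw [dotProduct_sum]
        refine Finset.sum_eq_zero fun l hl => ?_
        have hl' := Finset.mem_range.1 hl
        have hk' := Finset.mem_range.1 hk
        rw [dotProduct_smul, transpose_revCols_mul_eq_one_iff.1 hdual k hk' l (by omega),
          if_neg (by omega), smul_zero]
      rw [dotProduct_add, hz, hε]
      simp only [dotProduct_sub]
      generalize y k ⬝ᵥ u = a
      generalize y k ⬝ᵥ A *ᵥ v = b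
      revert a b; decide
    rw [Finset.sum_congr rfl hterm, Finset.sum_range, ← Equiv.sum_comp Fin.revPerm]
    have : ∑ i : Fin n, (y (Fin.revPerm i) ⬝ᵥ u) * (y (Fin.revPerm i) ⬝ᵥ A *ᵥ v) =
        ((revCols y)ᵀ *ᵥ u) ⬝ᵥ ((revCols y)ᵀ *ᵥ (A *ᵥ v)) := rfl
    rw [this, hAB, Matrix.mulVec_mulVec, ← mul_assoc, hdual, one_mul, Matrix.dotProduct_mulVec,
      Matrix.vecMul_transpose, Matrix.mulVec_mulVec, mul_eq_one_comm.1 hdual, Matrix.one_mulVec]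

theorem Cmat_apply (m : ℕ) (r c : Fin (m + 1)) :
    Cmat (m + 1) r c = if c = r + 1 then 1 else 0 := by
  have h : (c.val = r.val + 1 ∨ (r.val = m + 1 - 1 ∧ c.val = 0)) ↔ c = r + 1 := by
    rw [Fin.ext_iff, Fin.val_add_one]
    split_ifs with hr
    · subst hr
      simp only [Fin.val_last]
      omega
    · have : r.val ≠ m := fun hc => hr (Fin.ext hc)
      omega
  simp only [Cmat, Matrix.of_apply, h]

theorem ofNat_of_lt {m k : ℕ} (hk : k < m + 1) : Fin.ofNat (m + 1) k = ⟨k, hk⟩ := by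
  ext
  rw [Fin.val_ofNat, Nat.mod_eq_of_lt hk]

theorem Cmat_pow_apply (m k : ℕ) (r c : Fin (m + 1)) :
    (Cmat (m + 1) ^ k) r c = if c = r + Fin.ofNat (m + 1) k then 1 else 0 := by
  induction k generalizing c with
  | zero => simp [Matrix.one_apply, eq_comm]
  | succ k ih =>
    have h : Fin.ofNat (m + 1) (k + 1) = Fin.ofNat (m + 1) k + 1 := by
      ext
      simp [Fin.val_add]
    simp only [pow_succ, Matrix.mul_apply, ih, Cmat_apply, h, ← add_assoc, ite_mul, one_mul,
      zero_mul, Finset.sum_ite_eq', Finset.mem_univ, if_true]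

theorem Cmat_pow_self (m : ℕ) : Cmat (m + 1) ^ (m + 1) = 1 := by
  ext r c
  have h : Fin.ofNat (m + 1) (m + 1) = 0 := by
    ext
    simp
  rw [Cmat_pow_apply, h, add_zero, Matrix.one_apply]
  simp only [eq_comm]

theorem isUnit_Cmat (m : ℕ) : IsUnit (Cmat (m + 1)) :=
  IsUnit.of_pow_eq_one (Cmat_pow_self m) (Nat.succ_ne_zero m)

theorem rev_add_ofNat_eq_last (m : ℕ) (k : Fin (m + 1)) :
    Fin.rev k + Fin.ofNat (m + 1) k = Fin.last m := by
  rw [ofNat_of_lt k.isLt]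
  ext
  rw [Fin.val_add, Fin.val_rev, Fin.val_last, Nat.mod_eq_of_lt] <;>
    simp only <;> omega

theorem Cmat_pow_mulVec_last (m : ℕ) (k : Fin (m + 1)) :
    Cmat (m + 1) ^ k.val *ᵥ Pi.single (Fin.last m) 1 = Pi.single (Fin.rev k) 1 := by
  ext r
  rw [Matrix.mulVec_single_one, Matrix.col_apply, Cmat_pow_apply, Pi.single_apply]
  refine if_congr ?_ rfl rfl
  rw [← rev_add_ofNat_eq_last m k, add_left_inj, eq_comm]

theorem single_rev_vecMul_Cmat_pow (m : ℕ) (k : Fin (m + 1)) :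
    Pi.single (Fin.rev k) 1 ᵥ* Cmat (m + 1) ^ k.val = Pi.single (Fin.last m) 1 := by
  ext c
  rw [Matrix.single_one_vecMul, Matrix.row_apply, Cmat_pow_apply, Pi.single_apply,
    rev_add_ofNat_eq_last m k]

theorem diagOne_castSucc_castSucc (m : ℕ) (Q : Matrix (Fin m) (Fin m) (ZMod 2)) (i j : Fin m) :
    diagOne m Q i.castSucc j.castSucc = Q i j := by
  have h (k : Fin m) : finSumFinEquiv.symm k.castSucc = (Sum.inl k : Fin m ⊕ Fin 1) := by
    rw [Equiv.symm_apply_eq]; rfl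
  simp [diagOne, h]

theorem diagOne_last (m : ℕ) (Q : Matrix (Fin m) (Fin m) (ZMod 2)) (i : Fin (m + 1)) :
    diagOne m Q i (Fin.last m) = (Pi.single (Fin.last m) 1 : Fin (m + 1) → ZMod 2) i := by
  have hl : finSumFinEquiv.symm (Fin.last m) = (Sum.inr 0 : Fin m ⊕ Fin 1) := by
    rw [Equiv.symm_apply_eq]; rfl
  have h (k : Fin m) : finSumFinEquiv.symm k.castSucc = (Sum.inl k : Fin m ⊕ Fin 1) := by
    rw [Equiv.symm_apply_eq]; rfl
  induction i using Fin.lastCases with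
  | last => simp [diagOne, hl]
  | cast i => simp [diagOne, hl, h]

theorem last_diagOne (m : ℕ) (Q : Matrix (Fin m) (Fin m) (ZMod 2)) (i : Fin (m + 1)) :
    diagOne m Q (Fin.last m) i = (Pi.single (Fin.last m) 1 : Fin (m + 1) → ZMod 2) i := by
  have hl : finSumFinEquiv.symm (Fin.last m) = (Sum.inr 0 : Fin m ⊕ Fin 1) := by
    rw [Equiv.symm_apply_eq]; rfl
  have h (k : Fin m) : finSumFinEquiv.symm k.castSucc = (Sum.inl k : Fin m ⊕ Fin 1) := by
    rw [Equiv.symm_apply_eq]; rfl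
  induction i using Fin.lastCases with
  | last => simp [diagOne, hl]
  | cast i => simp [diagOne, hl, h]

theorem diagOne_mulVec_last (m : ℕ) (Q : Matrix (Fin m) (Fin m) (ZMod 2)) :
    diagOne m Q *ᵥ Pi.single (Fin.last m) 1 = Pi.single (Fin.last m) 1 := by
  ext i
  rw [Matrix.mulVec_single_one, Matrix.col_apply, diagOne_last]

theorem last_vecMul_diagOne (m : ℕ) (Q : Matrix (Fin m) (Fin m) (ZMod 2)) :
    Pi.single (Fin.last m) 1 ᵥ* diagOne m Q = Pi.single (Fin.last m) 1 := by
  ext i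
  rw [Matrix.single_one_vecMul, Matrix.row_apply, last_diagOne]

theorem diagOne_injective (m : ℕ) : Function.Injective (diagOne m) := by
  intro Q Q' h
  ext i j
  rw [← diagOne_castSucc_castSucc m Q, h, diagOne_castSucc_castSucc]

theorem det_diagOne (m : ℕ) (Q : Matrix (Fin m) (Fin m) (ZMod 2)) :
    (diagOne m Q).det = Q.det := by
  simp [diagOne]

theorem isUnit_diagOne_iff {m : ℕ} {Q : Matrix (Fin m) (Fin m) (ZMod 2)} :
    IsUnit (diagOne m Q) ↔ IsUnit Q := by
  rw [Matrix.isUnit_iff_isUnit_det, Matrix.isUnit_iff_isUnit_det, det_diagOne]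

theorem diagOne_mul_diagOne_inv {m : ℕ} {Q : Matrix (Fin m) (Fin m) (ZMod 2)} (hQ : IsUnit Q) :
    diagOne m Q * diagOne m Q⁻¹ = 1 := by
  have hdet := (Matrix.isUnit_iff_isUnit_det Q).1 hQ
  simp [diagOne, Matrix.submatrix_mul_equiv, Matrix.fromBlocks_multiply,
    Matrix.mul_nonsing_inv _ hdet]

theorem exists_diagOne_eq {m : ℕ} {G : Matrix (Fin (m + 1)) (Fin (m + 1)) (ZMod 2)}
    (h₁ : G *ᵥ Pi.single (Fin.last m) 1 = Pi.single (Fin.last m) 1)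
    (h₂ : Pi.single (Fin.last m) 1 ᵥ* G = Pi.single (Fin.last m) 1) :
    ∃ Q, diagOne m Q = G := by
  rw [Matrix.mulVec_single_one] at h₁
  rw [Matrix.single_one_vecMul] at h₂
  refine ⟨G.submatrix Fin.castSucc Fin.castSucc, ?_⟩
  ext i j
  induction j using Fin.lastCases with
  | last => rw [diagOne_last, ← h₁, Matrix.col_apply]
  | cast j =>
    induction i using Fin.lastCases with
    | last => rw [last_diagOne, ← h₂, Matrix.row_apply]
    | cast i => rw [diagOne_castSucc_castSucc, Matrix.submatrix_apply]

section mkP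

variable {m : ℕ} {B : Matrix (Fin (m + 1)) (Fin (m + 1)) (ZMod 2)}
  {Q : ℕ → Matrix (Fin m) (Fin m) (ZMod 2)}

theorem partialProd_mkP (hQ : ∀ k, 1 ≤ k → k ≤ m + 1 → IsUnit (Q k)) {k : ℕ} (hk : k ≤ m) :
    partialProd (mkP m B Q) k = B * Cmat (m + 1) ^ k * diagOne m (Q (k + 1)) := by
  induction k with
  | zero => simp [partialProd, mkP]
  | succ k ih =>
    have h : mkP m B Q (k + 1) =
        diagOne m (Q (k + 1))⁻¹ * Cmat (m + 1) * diagOne m (Q (k + 1 + 1)) := by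
      rw [mkP, if_neg (by omega), if_pos (by omega)]
    rw [partialProd, ih (by omega), h, mul_assoc, mul_assoc, ← mul_assoc (diagOne m (Q (k + 1))),
      ← mul_assoc (diagOne m (Q (k + 1))), diagOne_mul_diagOne_inv (hQ _ (by omega) (by omega)),
      one_mul, pow_succ]
    simp only [mul_assoc]

theorem partialProd_mkP_succ (hQ : ∀ k, 1 ≤ k → k ≤ m + 1 → IsUnit (Q k)) :
    partialProd (mkP m B Q) (m + 1) = B * Bᵀ := by
  have h : mkP m B Q (m + 1) = diagOne m (Q (m + 1))⁻¹ * Cmat (m + 1) * Bᵀ := by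
    rw [mkP, if_neg (by omega), if_neg (by omega), if_pos rfl]
  rw [partialProd, partialProd_mkP hQ le_rfl, h, mul_assoc, mul_assoc,
    ← mul_assoc (diagOne m (Q (m + 1))), ← mul_assoc (diagOne m (Q (m + 1))),
    diagOne_mul_diagOne_inv (hQ _ (by omega) (by omega)), one_mul, ← mul_assoc (_ ^ m),
    ← pow_succ, Cmat_pow_self, one_mul]

theorem isUnit_mkP (hB : IsUnit B) (hQ : ∀ k, 1 ≤ k → k ≤ m + 1 → IsUnit (Q k)) (k : ℕ) :
    IsUnit (mkP m B Q k) := by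
  have hinv : ∀ k, 1 ≤ k → k ≤ m + 1 → IsUnit (diagOne m (Q k)⁻¹) := fun k h₁ h₂ =>
    isUnit_diagOne_iff.2 (Matrix.isUnit_nonsing_inv_iff.2 (hQ k h₁ h₂))
  rw [mkP]
  split_ifs with h₁ h₂ h₃
  · exact hB.mul (isUnit_diagOne_iff.2 (hQ 1 le_rfl (by omega)))
  · exact ((hinv k (by omega) (by omega)).mul (isUnit_Cmat m)).mul
      (isUnit_diagOne_iff.2 (hQ _ (by omega) (by omega)))
  · exact ((hinv _ (by omega) le_rfl).mul (isUnit_Cmat m)).mul ((Matrix.isUnit_transpose B).2 hB)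
  · exact isUnit_one

theorem revCols_partialProd_mkP (hQ : ∀ k, 1 ≤ k → k ≤ m + 1 → IsUnit (Q k)) :
    revCols (fun k => partialProd (mkP m B Q) k *ᵥ Pi.single (Fin.last m) 1) = B := by
  ext r c
  have hle : (Fin.rev c).val ≤ m := by have := (Fin.rev c).isLt; omega
  rw [revCols, Matrix.of_apply, partialProd_mkP hQ hle, ← Matrix.mulVec_mulVec,
    diagOne_mulVec_last, ← Matrix.mulVec_mulVec, Cmat_pow_mulVec_last, Fin.rev_rev,
    Matrix.mulVec_single_one, Matrix.col_apply]

end mkP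

theorem partialProd_congr {n N : ℕ} {P P' : ℕ → Matrix (Fin n) (Fin n) (ZMod 2)}
    (h : ∀ k ≤ N, P k = P' k) {k : ℕ} (hk : k ≤ N) : partialProd P k = partialProd P' k := by
  induction k with
  | zero => exact h 0 hk
  | succ k ih => rw [partialProd, partialProd, ih (by omega), h _ hk]

theorem eq_of_partialProd_eq {n N : ℕ} {P P' : ℕ → Matrix (Fin n) (Fin n) (ZMod 2)}
    (hP : ∀ k ≤ N, IsUnit (P k)) (h : ∀ k ≤ N, partialProd P k = partialProd P' k)
    {k : ℕ} (hk : k ≤ N) : P k = P' k := by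
  cases k with
  | zero => exact h 0 hk
  | succ k =>
    have h1 := h (k + 1) hk
    rw [partialProd, partialProd, ← h k (by omega)] at h1
    exact (isUnit_partialProd fun j hj => hP j (by omega)).mul_left_cancel h1

theorem mkP_injective {m : ℕ} {B B' : Matrix (Fin (m + 1)) (Fin (m + 1)) (ZMod 2)}
    {Q Q' : ℕ → Matrix (Fin m) (Fin m) (ZMod 2)} (hB : IsUnit B)
    (hQ : ∀ k, 1 ≤ k → k ≤ m + 1 → IsUnit (Q k)) (hQ' : ∀ k, 1 ≤ k → k ≤ m + 1 → IsUnit (Q' k))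
    (h : ∀ i ≤ m + 1, mkP m B Q i = mkP m B' Q' i) :
    B = B' ∧ ∀ k, 1 ≤ k → k ≤ m + 1 → Q k = Q' k := by
  have hpre : ∀ k ≤ m, partialProd (mkP m B Q) k = partialProd (mkP m B' Q') k := fun k hk =>
    partialProd_congr h (by omega)
  have hBB : B = B' := by
    rw [← revCols_partialProd_mkP (B := B) hQ, ← revCols_partialProd_mkP (B := B') hQ']
    ext r c
    have hle : (Fin.rev c).val ≤ m := by have := (Fin.rev c).isLt; omega
    rw [revCols, revCols, Matrix.of_apply, Matrix.of_apply, hpre _ hle]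
  refine ⟨hBB, fun k h₁ h₂ => ?_⟩
  obtain ⟨k, rfl⟩ : ∃ j, k = j + 1 := ⟨k - 1, by omega⟩
  have h3 := hpre k (by omega)
  rw [partialProd_mkP hQ (by omega), partialProd_mkP hQ' (by omega), ← hBB] at h3
  exact diagOne_injective m ((hB.mul ((isUnit_Cmat m).pow k)).mul_left_cancel h3)

theorem W_eq_hadamardH_iff {m : ℕ} {P : ℕ → Matrix (Fin (m + 1)) (Fin (m + 1)) (ZMod 2)}
    (hP : ∀ k ≤ m + 1, IsUnit (P k)) :
    W (m + 1) P = hadamardH (m + 1) ↔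
      ∃ (B : Matrix (Fin (m + 1)) (Fin (m + 1)) (ZMod 2))
        (Q : ℕ → Matrix (Fin m) (Fin m) (ZMod 2)), IsUnit B ∧
        (∀ k, 1 ≤ k → k ≤ m + 1 → IsUnit (Q k)) ∧ ∀ k ≤ m + 1, mkP m B Q k = P k := by
  have hpre : ∀ k ≤ m + 1, IsUnit (partialProd P k) := fun k hk =>
    isUnit_partialProd fun j hj => hP j (by omega)
  have hpdet : ∀ k ≤ m + 1, IsUnit (partialProd P k).det := fun k hk =>
    (Matrix.isUnit_iff_isUnit_det _).1 (hpre k hk)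
  rw [W_eq_hadamardH_iff_forall m P fun k hk => hP k (by omega),
    butterflyProd_eq_hadamard_iff (hpre _ le_rfl)]
  swap
  · intro k hk
    rw [← Matrix.dotProduct_mulVec, Matrix.mulVec_mulVec,
      Matrix.nonsing_inv_mul _ (hpdet k (by omega)), Matrix.one_mulVec, dotProduct_single_one,
      Pi.single_eq_same]
  constructor
  · rintro ⟨hdual, hA⟩
    set x : ℕ → Fin (m + 1) → ZMod 2 :=
      fun k => partialProd P k *ᵥ Pi.single (Fin.last m) 1
    set y : ℕ → Fin (m + 1) → ZMod 2 :=
      fun k => Pi.single (Fin.last m) 1 ᵥ* (partialProd P k)⁻¹ with hy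
    have hB : IsUnit (revCols x) := .of_mul_eq_one_right _ hdual
    have hD : ∀ k : Fin (m + 1), ∃ Q,
        revCols x * Cmat (m + 1) ^ k.val * diagOne m Q = partialProd P k := by
      intro k
      have hE := hB.mul ((isUnit_Cmat m).pow k.val)
      have hEdet := (Matrix.isUnit_iff_isUnit_det _).1 hE
      have hxk : (revCols x * Cmat (m + 1) ^ k.val) *ᵥ Pi.single (Fin.last m) 1 = x k := by
        rw [← Matrix.mulVec_mulVec, Cmat_pow_mulVec_last, Matrix.mulVec_single_one]
        ext r
        simp only [Matrix.col_apply, revCols, Matrix.of_apply, Fin.rev_rev]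
      have hyk : y k ᵥ* (revCols x * Cmat (m + 1) ^ k.val) = Pi.single (Fin.last m) 1 := by
        have h1 : y k = Pi.single (Fin.rev k) 1 ᵥ* (revCols y)ᵀ := by
          rw [Matrix.single_one_vecMul]
          ext r
          simp only [Matrix.row_apply, Matrix.transpose_apply, revCols, Matrix.of_apply,
            Fin.rev_rev]
        rw [h1, Matrix.vecMul_vecMul, ← mul_assoc, hdual, one_mul, single_rev_vecMul_Cmat_pow]
      obtain ⟨Q, hQ⟩ := exists_diagOne_eq
        (G := (revCols x * Cmat (m + 1) ^ k.val)⁻¹ * partialProd P k)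
        (by
          rw [← Matrix.mulVec_mulVec]
          change _ *ᵥ x k = _
          rw [← hxk, Matrix.mulVec_mulVec, Matrix.nonsing_inv_mul _ hEdet, Matrix.one_mulVec])
        (by
          conv_lhs => rw [← hyk]
          rw [Matrix.vecMul_vecMul, Matrix.mul_nonsing_inv_cancel_left _ _ hEdet, hy,
            Matrix.vecMul_vecMul, Matrix.nonsing_inv_mul _ (hpdet _ (by omega)),
            Matrix.vecMul_one])
      exact ⟨Q, by rw [hQ, Matrix.mul_nonsing_inv_cancel_left _ _ hEdet]⟩
    choose q hq using hD
    have hqu : ∀ k, IsUnit (q k) := by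
      intro k
      rw [← isUnit_diagOne_iff, ← (hB.mul ((isUnit_Cmat m).pow k.val)).mul_left_iff, hq]
      exact hpre _ (by omega)
    obtain ⟨Q, hQq⟩ : ∃ Q : ℕ → Matrix (Fin m) (Fin m) (ZMod 2),
        ∀ k : Fin (m + 1), Q (k.val + 1) = q k := by
      refine ⟨fun k => q (Fin.ofNat (m + 1) (k - 1)), fun k => ?_⟩
      beta_reduce
      rw [add_tsub_cancel_right, ofNat_of_lt k.isLt]
    have hQ : ∀ k, 1 ≤ k → k ≤ m + 1 → IsUnit (Q k) := by
      intro k h₁ h₂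
      obtain ⟨k, rfl⟩ : ∃ j, k = j + 1 := ⟨k - 1, by omega⟩
      exact hQq ⟨k, h₂⟩ ▸ hqu ⟨k, h₂⟩
    refine ⟨revCols x, Q, hB, hQ, fun k hk => ?_⟩
    refine eq_of_partialProd_eq (fun k _ => isUnit_mkP hB hQ k) (fun k hk => ?_) hk
    rcases hk.lt_or_eq with hk | rfl
    · rw [partialProd_mkP hQ (by omega), ← hq ⟨k, hk⟩, ← hQq ⟨k, hk⟩]
    · rw [partialProd_mkP_succ hQ, ← hA]
  · rintro ⟨B, Q, hB, hQ, h⟩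
    have hcongr : ∀ k ≤ m + 1, partialProd P k = partialProd (mkP m B Q) k := fun k hk =>
      (partialProd_congr h hk).symm
    have hx : revCols (fun k => partialProd P k *ᵥ Pi.single (Fin.last m) 1) = B := by
      conv_rhs => rw [← revCols_partialProd_mkP (B := B) hQ]
      ext r c
      have hle : (Fin.rev c).val ≤ m + 1 := by have := (Fin.rev c).isLt; omega
      rw [revCols, revCols, Matrix.of_apply, Matrix.of_apply, hcongr _ hle]
    rw [hx, hcongr _ le_rfl, partialProd_mkP_succ hQ]
    refine ⟨?_, rfl⟩
    have hBdet := (Matrix.isUnit_iff_isUnit_det B).1 hB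
    suffices hy : (revCols fun k => Pi.single (Fin.last m) 1 ᵥ* (partialProd P k)⁻¹)ᵀ = B⁻¹ by
      rw [hy, Matrix.nonsing_inv_mul _ hBdet]
    ext r c
    have hle : (Fin.rev r).val ≤ m := by have := (Fin.rev r).isLt; omega
    have hD := hpdet (Fin.rev r) (by omega)
    have hA := partialProd_mkP (B := B) hQ hle
    rw [← hcongr _ (by omega)] at hA
    have h1 : Pi.single (Fin.last m) 1 ᵥ* (partialProd P (Fin.rev r))⁻¹ =
        Pi.single r 1 ᵥ* B⁻¹ := by
      have h2 : Pi.single r 1 ᵥ* B⁻¹ ᵥ* partialProd P (Fin.rev r) =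
          Pi.single (Fin.last m) 1 := by
        have h3 := single_rev_vecMul_Cmat_pow m (Fin.rev r)
        rw [Fin.rev_rev] at h3
        rw [hA, Matrix.vecMul_vecMul, mul_assoc B, Matrix.nonsing_inv_mul_cancel_left _ _ hBdet,
          ← Matrix.vecMul_vecMul, h3, last_vecMul_diagOne]
      rw [← h2, Matrix.vecMul_vecMul _ (partialProd P _), Matrix.mul_nonsing_inv _ hD,
        Matrix.vecMul_one]
    rw [Matrix.transpose_apply, revCols, Matrix.of_apply, h1, Matrix.single_one_vecMul,
      Matrix.row_apply]

/-- The parametrization of the enumeration corollary is injective; consequently the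
number of `DFT_2`-based linear fast WHT algorithms (for `n = m + 1`) is
`∏_{i=0}^{n-1}(2^n − 2^i) · (∏_{i=0}^{n-2}(2^{n-1} − 2^i))^n`. -/
theorem enumeration_injective_and_count (m : ℕ) :
    (∀ (B B' : Matrix (Fin (m + 1)) (Fin (m + 1)) (ZMod 2))
        (Q Q' : ℕ → Matrix (Fin m) (Fin m) (ZMod 2)),
      IsUnit B → IsUnit B' →
      (∀ k, 1 ≤ k → k ≤ m + 1 → IsUnit (Q k) ∧ IsUnit (Q' k)) →
      (∀ i ≤ m + 1, mkP m B Q i = mkP m B' Q' i) →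
      B = B' ∧ ∀ k, 1 ≤ k → k ≤ m + 1 → Q k = Q' k) ∧
    Nat.card {P : Fin (m + 2) → Matrix (Fin (m + 1)) (Fin (m + 1)) (ZMod 2) //
        (∀ k, IsUnit (P k)) ∧
        W (m + 1) (fun t => if h : t < m + 2 then P ⟨t, h⟩ else 1) = hadamardH (m + 1)} =
      (∏ i ∈ Finset.range (m + 1), (2 ^ (m + 1) - 2 ^ i)) *
        (∏ i ∈ Finset.range m, (2 ^ m - 2 ^ i)) ^ (m + 1) := by
  refine ⟨fun B B' Q Q' hB _ hQ h => mkP_injective hB (fun k h₁ h₂ => (hQ k h₁ h₂).1)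
    (fun k h₁ h₂ => (hQ k h₁ h₂).2) h, ?_⟩
  have hcard : ∀ n, Nat.card (GL (Fin n) (ZMod 2)) = ∏ i ∈ Finset.range n, (2 ^ n - 2 ^ i) := by
    intro n
    rw [Matrix.card_GL_field, Finset.prod_range, ZMod.card]
  have hGL : ∀ {n : ℕ} (M : GL (Fin n) (ZMod 2)), IsUnit M.val := fun M => M.isUnit
  rw [← hcard, ← hcard]
  trans Nat.card (GL (Fin (m + 1)) (ZMod 2) × (Fin (m + 1) → GL (Fin m) (ZMod 2)))
  swap
  · rw [Nat.card_prod, Nat.card_fun, Nat.card_fin]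
  symm
  let seq : GL (Fin (m + 1)) (ZMod 2) × (Fin (m + 1) → GL (Fin m) (ZMod 2)) →
      ℕ → Matrix (Fin (m + 1)) (Fin (m + 1)) (ZMod 2) :=
    fun p => mkP m p.1.val fun k => (p.2 (Fin.ofNat (m + 1) (k - 1))).val
  have hseq : ∀ p k, IsUnit (seq p k) := fun p k => isUnit_mkP (hGL _) (fun _ _ _ => hGL _) k
  have hmem : ∀ p, W (m + 1) (fun t => if h : t < m + 2 then seq p t else 1) =
      hadamardH (m + 1) := by
    intro p
    rw [W_eq_hadamardH_iff]
    · refine ⟨p.1.val, fun k => (p.2 (Fin.ofNat (m + 1) (k - 1))).val, hGL p.1,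
        fun _ _ _ => hGL _, fun k hk => ?_⟩
      rw [dif_pos (by omega)]
    · intro k hk
      rw [dif_pos (by omega)]
      exact hseq p k
  refine Nat.card_eq_of_bijective
    (fun p => ⟨fun t => seq p t.val, fun t => hseq p t.val, hmem p⟩) ⟨?_, ?_⟩
  · intro p p' h
    have h1 : ∀ i ≤ m + 1, seq p i = seq p' i := fun i hi =>
      congrFun (congrArg Subtype.val h) ⟨i, by omega⟩
    obtain ⟨h2, h3⟩ := mkP_injective (B := p.1.val) (B' := p'.1.val)
      (Q := fun k => (p.2 (Fin.ofNat (m + 1) (k - 1))).val)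
      (Q' := fun k => (p'.2 (Fin.ofNat (m + 1) (k - 1))).val)
      (hGL p.1) (fun _ _ _ => hGL _) (fun _ _ _ => hGL _) h1
    refine Prod.ext (Units.ext h2) (funext fun k => Units.ext ?_)
    have h4 := h3 (k.val + 1) (by omega) (by omega)
    rwa [add_tsub_cancel_right, ofNat_of_lt k.isLt] at h4
  · rintro ⟨P, hP, hW⟩
    rw [W_eq_hadamardH_iff] at hW
    swap
    · intro k hk
      rw [dif_pos (by omega)]
      exact hP _
    obtain ⟨B, Q, hB, hQ, h⟩ := hW
    refine ⟨(hB.unit, fun k => (hQ (k.val + 1) (by omega) (by omega)).unit),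
      Subtype.ext (funext fun t => ?_)⟩
    have h1 := h t.val (by omega)
    rw [dif_pos t.isLt] at h1
    refine Eq.trans ?_ h1
    have hidx : ∀ k, 1 ≤ k → k ≤ m + 1 → (Fin.ofNat (m + 1) (k - 1)).val + 1 = k := by
      intro k h₁ h₂
      rw [Fin.val_ofNat, Nat.mod_eq_of_lt (by omega)]
      omega
    simp only [seq, IsUnit.unit_spec, mkP]
    split_ifs
    · rw [hidx 1 le_rfl (by omega)]
    · rw [hidx _ (by omega) (by omega), hidx _ (by omega) (by omega)]
    · rw [hidx _ (by omega) le_rfl]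
    · rfl
end

section
/- For n = 2, there are exactly 6 sequences (P_0, P_1, P_2) ∈ GL_2(F_2)^3 such that W(P) = H_2, where W(P) = P(P_0)·(I_2 ⊗ DFT_2)·P(P_1)·(I_2 ⊗ DFT_2)·P(P_2). -/
open Matrix

theorem bits_two_bijective : Function.Bijective (bits 2) := by decide +kernel

theorem permMat_two_mul (A B : Matrix (Fin 2) (Fin 2) (ZMod 2)) :
    permMat 2 (A * B) = permMat 2 A * permMat 2 B := by
  ext j i
  obtain ⟨k, hk⟩ := bits_two_bijective.2 (B *ᵥ bits 2 i)
  simp only [permMat, Matrix.mul_apply, Matrix.of_apply, ← Matrix.mulVec_mulVec, ← hk,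
    bits_two_bijective.1.eq_iff, mul_ite, mul_one, mul_zero, Finset.sum_ite_eq',
    Finset.mem_univ, if_true]

theorem permMat_two_one : permMat 2 1 = 1 := by decide +kernel

theorem permMat_transpose_mul_hadamardH_mul_permMat (Q : Matrix (Fin 2) (Fin 2) (ZMod 2))
    (hQ : IsUnit Q) : permMat 2 Qᵀ * hadamardH 2 * permMat 2 Q = hadamardH 2 := by
  have key : ∀ Q : Matrix (Fin 2) (Fin 2) (ZMod 2), Q 0 0 * Q 1 1 - Q 0 1 * Q 1 0 ≠ 0 →
      permMat 2 Qᵀ * hadamardH 2 * permMat 2 Q = hadamardH 2 := by decide +kernel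
  refine key Q ?_
  rw [← Matrix.det_fin_two]
  exact ((Matrix.isUnit_iff_isUnit_det Q).1 hQ).ne_zero

theorem butterflies_mul_permMat_mul_butterflies_eq_iff (A R : Matrix (Fin 2) (Fin 2) (ZMod 2))
    (hR : IsUnit R) :
    butterflies 2 * permMat 2 A * butterflies 2 = permMat 2 R * hadamardH 2 ↔
      A = Cmat 2 ∧ R = Cmat 2 := by
  have key : ∀ R : Matrix (Fin 2) (Fin 2) (ZMod 2), R 0 0 * R 1 1 - R 0 1 * R 1 0 ≠ 0 →
      ∀ A : Matrix (Fin 2) (Fin 2) (ZMod 2),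
      (butterflies 2 * permMat 2 A * butterflies 2 = permMat 2 R * hadamardH 2 ↔
        A = Cmat 2 ∧ R = Cmat 2) := by decide +kernel
  refine key R ?_ A
  rw [← Matrix.det_fin_two]
  exact ((Matrix.isUnit_iff_isUnit_det R).1 hR).ne_zero

theorem permMat_mul_butterflies_eq_hadamardH_iff (A B C : Matrix (Fin 2) (Fin 2) (ZMod 2))
    (hA : IsUnit A) (hC : IsUnit C) :
    permMat 2 A * (butterflies 2 * permMat 2 B * butterflies 2) * permMat 2 C = hadamardH 2 ↔
      B = Cmat 2 ∧ C = (Cmat 2)ᵀ * Aᵀ := by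
  obtain ⟨a, rfl⟩ := hA
  obtain ⟨c, rfl⟩ := hC
  have permMat_cancel (u v : Matrix (Fin 2) (Fin 2) (ZMod 2)) (h : u * v = 1) :
      permMat 2 u * permMat 2 v = 1 := by
    rw [← permMat_two_mul, h, permMat_two_one]
  have hct : IsUnit (c : Matrix (Fin 2) (Fin 2) (ZMod 2))ᵀ :=
    (Matrix.isUnit_transpose _).2 c.isUnit
  have ha := permMat_cancel _ _ a.mul_inv
  have ha' := permMat_cancel _ _ a.inv_mul
  have hc := permMat_cancel _ _ c.mul_inv
  have hc' := permMat_cancel _ _ c.inv_mul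
  have hH : hadamardH 2 * permMat 2 (↑c⁻¹ : Matrix (Fin 2) (Fin 2) (ZMod 2)) =
      permMat 2 (c : Matrix (Fin 2) (Fin 2) (ZMod 2))ᵀ * hadamardH 2 := by
    conv_lhs => rw [← permMat_transpose_mul_hadamardH_mul_permMat _ c.isUnit]
    rw [Matrix.mul_assoc, hc, Matrix.mul_one]
  have hR : IsUnit ((↑a⁻¹ : Matrix (Fin 2) (Fin 2) (ZMod 2)) *
      (c : Matrix (Fin 2) (Fin 2) (ZMod 2))ᵀ) := a⁻¹.isUnit.mul hct
  generalize hM : butterflies 2 * permMat 2 B * butterflies 2 = M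
  have step : permMat 2 (a : Matrix (Fin 2) (Fin 2) (ZMod 2)) * M * permMat 2 c = hadamardH 2 ↔
      M = permMat 2 ((↑a⁻¹ : Matrix (Fin 2) (Fin 2) (ZMod 2)) *
        (c : Matrix (Fin 2) (Fin 2) (ZMod 2))ᵀ) * hadamardH 2 := by
    rw [permMat_two_mul, Matrix.mul_assoc (permMat 2 _) _ (hadamardH 2), ← hH]
    constructor
    · intro h
      rw [← h]
      simp only [Matrix.mul_assoc, hc, Matrix.mul_one]
      rw [← Matrix.mul_assoc, ha', Matrix.one_mul]
    · rintro rfl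
      simp only [Matrix.mul_assoc, hc', Matrix.mul_one]
      rw [← Matrix.mul_assoc, ha, Matrix.one_mul]
  rw [step, ← hM, butterflies_mul_permMat_mul_butterflies_eq_iff _ _ hR,
    Units.inv_mul_eq_iff_eq_mul, ← Matrix.transpose_mul,
    ← Matrix.transpose_inj (A := (c : Matrix (Fin 2) (Fin 2) (ZMod 2))), Matrix.transpose_transpose]

theorem isUnit_Cmat_two : IsUnit (Cmat 2) :=
  IsUnit.of_mul_eq_one (Cmat 2) (by decide +kernel)

/-- For `n = 2`, there are exactly `6` sequences `(P₀, P₁, P₂) ∈ GL_2(F_2)³` with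
`W(P) = H_2`. -/
theorem count_n_two :
    Nat.card {P : Fin 3 → Matrix (Fin 2) (Fin 2) (ZMod 2) //
        (∀ k, IsUnit (P k)) ∧
        W 2 (fun t => if h : t < 3 then P ⟨t, h⟩ else 1) = hadamardH 2} = 6 := by
  have hW (P : Fin 3 → Matrix (Fin 2) (Fin 2) (ZMod 2)) :
      W 2 (fun t => if h : t < 3 then P ⟨t, h⟩ else 1) =
        permMat 2 (P 0) * (butterflies 2 * permMat 2 (P 1) * butterflies 2) *
          permMat 2 (P 2) := by
    simp [W, List.ofFn_succ, Matrix.mul_assoc]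
  let e : {P : Fin 3 → Matrix (Fin 2) (Fin 2) (ZMod 2) //
      (∀ k, IsUnit (P k)) ∧
      W 2 (fun t => if h : t < 3 then P ⟨t, h⟩ else 1) = hadamardH 2} ≃
        GL (Fin 2) (ZMod 2) :=
    { toFun := fun P => (P.2.1 0).unit
      invFun := fun g => ⟨![g, Cmat 2, (Cmat 2)ᵀ * (g : Matrix (Fin 2) (Fin 2) (ZMod 2))ᵀ], by
        have hC : IsUnit ((Cmat 2)ᵀ * (g : Matrix (Fin 2) (Fin 2) (ZMod 2))ᵀ) :=
          ((Matrix.isUnit_transpose _).2 isUnit_Cmat_two).mul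
            ((Matrix.isUnit_transpose _).2 g.isUnit)
        refine ⟨?_, ?_⟩
        · intro k
          fin_cases k
          exacts [g.isUnit, isUnit_Cmat_two, hC]
        · rw [hW]
          exact (permMat_mul_butterflies_eq_hadamardH_iff _ _ _ g.isUnit hC).2 ⟨rfl, rfl⟩⟩
      left_inv := by
        rintro ⟨P, hP, h⟩
        rw [hW, permMat_mul_butterflies_eq_hadamardH_iff _ _ _ (hP 0) (hP 2)] at h
        apply Subtype.ext
        funext k
        fin_cases k
        exacts [rfl, h.1.symm, h.2.symm]
      right_inv := fun g => Units.ext rfl }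
  rw [Nat.card_congr e, Matrix.card_GL_field]
  simp [Fin.prod_univ_two, ZMod.card]
end
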